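/- Hopf bifurcation of a 3-manifold with boundary inside a 3-manifold. Let M be a topological 3-manifold and let K ⊆ M be a compact 3-manifold with boundary such that ∂K is bicollared in M. Let f : [0,1] × M → M be a continuous family of homeomorphisms of M such that K is an attractor of f₀ and a repeller of f_λ for every λ ∈ (0,1]. Then there exists λ₀ > 0 such that for every λ with 0 < λ < λ₀ there exists a compact attractor K_λ of f_λ which is a topological spine of a compact subset of M homeomorphic to ∂K × [0,1] (so K_λ has the Borsuk homotopy type of ∂K); moreover K_λ converges to K upper semicontinuously as λ → 0. -/

import Mathlib

open Set Topology unitInterval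

/-- `A` is homeomorphic to an open subset of `B`. -/
def HomeoToOpen (A : Type*) [TopologicalSpace A] (B : Type*) [TopologicalSpace B] : Prop :=
  ∃ U : Set B, IsOpen U ∧ Nonempty (A ≃ₜ U)

/-- The half-space `ℝ^{n-1} × [0,∞)`. -/
abbrev HalfSpace (n : ℕ) : Type :=
  EuclideanSpace ℝ (Fin (n - 1)) × {t : ℝ // 0 ≤ t}

/-- Every point has an open neighborhood homeomorphic to an open subset of `ℝⁿ`. -/
def LocallyEuclidean (n : ℕ) (M : Type*) [TopologicalSpace M] : Prop :=
  ∀ x : M, ∃ V : Set M, IsOpen V ∧ x ∈ V ∧ HomeoToOpen V (EuclideanSpace ℝ (Fin n))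

/-- Every point has an open neighborhood homeomorphic to an open subset of the
half-space `ℝ^{n-1} × [0,∞)`. -/
def LocallyHalfSpace (n : ℕ) (M : Type*) [TopologicalSpace M] : Prop :=
  ∀ x : M, ∃ V : Set M, IsOpen V ∧ x ∈ V ∧ HomeoToOpen V (HalfSpace n)

/-- The manifold boundary of a space: points with no open neighborhood homeomorphic to
an open subset of `ℝⁿ`. -/
def spaceBoundary (n : ℕ) (M : Type*) [TopologicalSpace M] : Set M :=
  {x | ¬ ∃ V : Set M, IsOpen V ∧ x ∈ V ∧ HomeoToOpen V (EuclideanSpace ℝ (Fin n))}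

variable {X : Type*} [TopologicalSpace X]

/-- A subset which is a compact `n`-manifold with boundary (subspace topology). -/
def IsCompactMfldBdry (n : ℕ) (N : Set X) : Prop :=
  IsCompact N ∧ LocallyHalfSpace n ↥N

/-- The boundary of a subset which is a manifold with boundary, as a subset of the
ambient space. -/
def subsetBoundary (n : ℕ) (N : Set X) : Set X :=
  Subtype.val '' spaceBoundary n ↥N

/-- `S` is bicollared in the ambient space. -/
def Bicollared (S : Set X) : Prop :=
  ∃ b : ↥S × ↥(Set.Icc (-1 : ℝ) 1) → X,
    Topology.IsEmbedding b ∧ ∀ x : ↥S, b (x, ⟨0, by norm_num⟩) = (x : X)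

/-- `M` and `N` (compact `n`-manifolds with boundary, `N ⊆ int M`) are concentric:
`M \ int N` is homeomorphic to `∂M × [0,1]`. -/
def Concentric (n : ℕ) (M N : Set X) : Prop :=
  Nonempty (↥(M \ interior N) ≃ₜ ↥(subsetBoundary n M) × ↥(Set.Icc (0 : ℝ) 1))

/-- `K` is a topological spine of the compact `n`-manifold with boundary `N`:
`K ⊆ int N` and `N \ K` is homeomorphic to `∂N × [0,∞)`. -/
def IsSpine (n : ℕ) (N K : Set X) : Prop :=
  K ⊆ interior N ∧
    Nonempty (↥(N \ K) ≃ₜ ↥(subsetBoundary n N) × ↥(Set.Ici (0 : ℝ)))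

/-- The ω-limit set of `Y` under a map `f`. -/
def omegaSet (f : X → X) (Y : Set X) : Set X :=
  ⋂ (n : ℕ) (_ : 1 ≤ n), closure (⋃ (k : ℕ) (_ : n ≤ k), f^[k] '' Y)

/-- `K` is an attractor of the homeomorphism `f`. -/
def IsAttractor (f : X ≃ₜ X) (K : Set X) : Prop :=
  IsCompact K ∧ ∃ U : Set X, U ∈ 𝓝ˢ K ∧ K = omegaSet f U

/-- `K` is a repeller of the homeomorphism `f`. -/
def IsRepeller (f : X ≃ₜ X) (K : Set X) : Prop :=
  IsAttractor f.symm K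

/-- A continuous family of homeomorphisms parametrized by the unit interval. -/
def ContinuousFamily {M : Type*} [TopologicalSpace M] (f : unitInterval → M ≃ₜ M) : Prop :=
  Continuous (fun p : unitInterval × M => f p.1 p.2) ∧
    Continuous (fun p : unitInterval × M => (f p.1).symm p.2)

/-- `M` has the concentric rigidity property (as a subset of the ambient space). -/
def ConcentricRigidity (n : ℕ) (M : Set X) : Prop :=
  ∀ M₀ M₁ : Set X, IsCompactMfldBdry n M₀ → IsCompactMfldBdry n M₁ →
    M₀ ⊆ interior M₁ → M₁ ⊆ interior M →
    Bicollared (subsetBoundary n M₁) →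
    Nonempty (↥(subsetBoundary n M₁) ≃ₜ ↥(subsetBoundary n M)) →
    Concentric n M M₀ →
    Concentric n M₁ M₀ ∧ Concentric n M M₁

open Set Topology unitInterval

section InvDom
open MeasureTheory Metric

abbrev E3 : Type := EuclideanSpace ℝ (Fin 3)

lemma id_det_cubic (A : E3 →L[ℝ] E3) : ∃ e1 e2 e3 : ℝ, ∀ t : ℝ,
    (ContinuousLinearMap.id ℝ E3 + t • A).det = 1 + e1 * t + e2 * t ^ 2 + e3 * t ^ 3 := by
  let b := (EuclideanSpace.basisFun (Fin 3) ℝ).toBasis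
  let N := LinearMap.toMatrix b b (A : E3 →ₗ[ℝ] E3)
  have h : ∀ t : ℝ, (ContinuousLinearMap.id ℝ E3 + t • A).det = (1 + t • N).det := by
    intro t
    rw [ContinuousLinearMap.det, ← LinearMap.det_toMatrix b]
    congr 1
    simp [N]
  refine ⟨N 0 0 + N 1 1 + N 2 2,
    N 0 0 * N 1 1 - N 0 1 * N 1 0 + N 0 0 * N 2 2 - N 0 2 * N 2 0 + N 1 1 * N 2 2 - N 1 2 * N 2 1,
    N.det, fun t => ?_⟩
  rw [h, Matrix.det_fin_three, Matrix.det_fin_three]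
  simp [Matrix.add_apply, Matrix.smul_apply]
  ring

lemma id_det_pos (A : E3 →L[ℝ] E3) (hA : ‖A‖ < 1) :
    0 < (ContinuousLinearMap.id ℝ E3 + A).det := by
  have hne : ∀ t ∈ Icc (0:ℝ) 1, (ContinuousLinearMap.id ℝ E3 + t • A).det ≠ 0 := by
    intro t ht
    have h1 : ‖-(t • A)‖ < 1 := by
      rw [norm_neg, norm_smul, Real.norm_of_nonneg ht.1]
      nlinarith [ht.2, norm_nonneg A]
    have hu : IsUnit (ContinuousLinearMap.id ℝ E3 + t • A) := by
      have := (Units.oneSub _ h1).isUnit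
      rw [Units.val_oneSub, sub_neg_eq_add] at this
      exact this
    have h2 : IsUnit ((ContinuousLinearMap.id ℝ E3 + t • A : E3 →L[ℝ] E3) : E3 →ₗ[ℝ] E3) := by
      obtain ⟨v, hv⟩ := hu
      refine ⟨⟨(v.val : E3 →ₗ[ℝ] E3), (v.inv : E3 →ₗ[ℝ] E3), ?_, ?_⟩, ?_⟩
      · ext1 x; exact congrArg (fun B : E3 →L[ℝ] E3 => B x) v.val_inv
      · ext1 x; exact congrArg (fun B : E3 →L[ℝ] E3 => B x) v.inv_val
      · simp [hv]
    exact (LinearMap.isUnit_det _ h2).ne_zero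
  obtain ⟨e1, e2, e3, he⟩ := id_det_cubic A
  by_contra hcon
  have hc : ContinuousOn (fun t : ℝ => (ContinuousLinearMap.id ℝ E3 + t • A).det) (Icc 0 1) := by
    simp only [he]; fun_prop
  have := intermediate_value_Icc' (zero_le_one (α := ℝ)) hc
  obtain ⟨t, ht, h0⟩ := this (show (0:ℝ) ∈ _ by
    constructor
    · simpa using hcon
    · simp only [he]; norm_num)
  exact hne t ht h0

lemma id_vol (H : E3 → E3) (L : NNReal) (hL : LipschitzWith L H) (R : ℝ)
    (hout : ∀ x, R ≤ ‖x‖ → H x = 0) (hd : ∀ x ∈ ball (0:E3) R, DifferentiableAt ℝ H x)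
    (t : ℝ) (ht0 : 0 ≤ t) (ht : t * L < 1) :
    IntegrableOn (fun x => (ContinuousLinearMap.id ℝ E3 + t • fderiv ℝ H x).det) (ball 0 R) ∧
    ∫ x in ball (0:E3) R, (ContinuousLinearMap.id ℝ E3 + t • fderiv ℝ H x).det
      = volume.real (ball (0:E3) R) := by
  let g : E3 → E3 := fun x => x + t • H x
  have happ : ApproximatesLinearOn g ((ContinuousLinearEquiv.refl ℝ E3 : E3 ≃L[ℝ] E3) : E3 →L[ℝ] E3)
      univ (t.toNNReal * L) := by
    intro x _ y _
    have : g x - g y - (x - y) = t • (H x - H y) := by simp only [g, smul_sub]; abel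
    simp only [ContinuousLinearEquiv.coe_refl, ContinuousLinearMap.coe_id', id]
    rw [this, norm_smul, Real.norm_of_nonneg ht0]
    have := hL.norm_sub_le x y
    push_cast
    rw [Real.coe_toNNReal t ht0, mul_assoc]
    gcongr
  have hc : Subsingleton E3 ∨ t.toNNReal * L <
      ‖((ContinuousLinearEquiv.refl ℝ E3).symm : E3 →L[ℝ] E3)‖₊⁻¹ := by
    right
    have : ‖((ContinuousLinearEquiv.refl ℝ E3).symm : E3 →L[ℝ] E3)‖₊ = 1 := by
      ext
      simp
    rw [this, inv_one, ← NNReal.coe_lt_coe]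
    push_cast
    rwa [Real.coe_toNNReal t ht0]
  have hinj : Function.Injective g := injOn_univ.1 (happ.injOn hc)
  have hsurj : Function.Surjective g := happ.surjective hc
  have hgout : ∀ x, R ≤ ‖x‖ → g x = x := fun x hx => by simp [g, hout x hx]
  have himg : g '' ball 0 R = ball 0 R := by
    apply Subset.antisymm
    · rintro _ ⟨x, hx, rfl⟩
      by_contra hcon
      simp only [mem_ball, dist_zero_right, not_lt] at hcon hx
      have := hinj (hgout _ hcon)
      rw [this] at hcon
      linarith
    · intro y hy
      obtain ⟨x, rfl⟩ := hsurj y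
      refine ⟨x, ?_, rfl⟩
      by_contra hcon
      simp only [mem_ball, dist_zero_right, not_lt] at hcon hy
      rw [hgout x hcon] at hy
      linarith
  have hder : ∀ x ∈ ball (0:E3) R, HasFDerivWithinAt g
      (ContinuousLinearMap.id ℝ E3 + t • fderiv ℝ H x) (ball 0 R) x := by
    intro x hx
    exact ((hasFDerivAt_id x).add ((hd x hx).hasFDerivAt.const_smul t)).hasFDerivWithinAt
  have hpos : ∀ x, 0 < (ContinuousLinearMap.id ℝ E3 + t • fderiv ℝ H x).det := by
    intro x
    apply id_det_pos
    rw [norm_smul, Real.norm_of_nonneg ht0]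
    have : ‖fderiv ℝ H x‖ ≤ L := norm_fderiv_le_of_lipschitz ℝ hL
    exact lt_of_le_of_lt (by gcongr) ht
  have h1 := integral_image_eq_integral_abs_det_fderiv_smul volume measurableSet_ball hder
    hinj.injOn (fun _ => (1:ℝ))
  have h2 := integrableOn_image_iff_integrableOn_abs_det_fderiv_smul volume measurableSet_ball hder
    hinj.injOn (fun _ => (1:ℝ))
  rw [himg] at h1 h2
  simp only [smul_eq_mul, mul_one, abs_of_pos (hpos _)] at h1 h2
  refine ⟨h2.1 (integrableOn_const measure_ball_lt_top.ne), ?_⟩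
  rw [← h1]; simp

lemma id_nodet (H : E3 → E3) (L : NNReal) (hL : LipschitzWith L H) (R : ℝ) (hR : 0 < R)
    (hout : ∀ x, R ≤ ‖x‖ → H x = 0) (hd : ∀ x ∈ ball (0:E3) R, DifferentiableAt ℝ H x)
    (hdet : ∀ x ∈ ball (0:E3) R, (ContinuousLinearMap.id ℝ E3 + fderiv ℝ H x).det = 0) : False := by
  let τ : ℝ := 1 / (3 * L + 1)
  have hLn : (0:ℝ) ≤ L := L.2
  have hτ : 0 < τ := by positivity
  have hτL : 3 * τ * L < 1 := by
    have : 3 * τ * L = 3 * L / (3 * L + 1) := by simp only [τ]; ring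
    rw [this, div_lt_one (by positivity)]; linarith
  have key := fun t h0 h1 => id_vol H L hL R hout hd t h0 h1
  have k0 := key 0 le_rfl (by simp)
  have k1 := key τ hτ.le (by nlinarith)
  have k2 := key (2*τ) (by positivity) (by nlinarith)
  have k3 := key (3*τ) (by positivity) hτL
  set q : ℝ → E3 → ℝ := fun t x => (ContinuousLinearMap.id ℝ E3 + t • fderiv ℝ H x).det with hq
  have hlag : ∃ c0 c1 c2 c3 : ℝ, c0 + c1 + c2 + c3 = 1 ∧ ∀ x, q 1 x =
      c0 * q 0 x + c1 * q τ x + c2 * q (2*τ) x + c3 * q (3*τ) x := by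
    obtain ⟨u, hu⟩ : ∃ u, u * τ = 1 := ⟨1/τ, by field_simp⟩
    refine ⟨-(u-1)*(u-2)*(u-3)/6, u*(u-2)*(u-3)/2, -u*(u-1)*(u-3)/2, u*(u-1)*(u-2)/6, by ring, ?_⟩
    intro x
    obtain ⟨e1, e2, e3, he⟩ := id_det_cubic (fderiv ℝ H x)
    simp only [hq, he]
    have : (1:ℝ) + e1 * 1 + e2 * 1^2 + e3 * 1^3 = 1 + e1 * (u * τ) + e2 * (u*τ)^2 + e3 * (u*τ)^3 := by
      rw [hu]
    rw [this]; ring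
  obtain ⟨c0, c1, c2, c3, hsum, hx⟩ := hlag
  have hI : ∫ x in ball (0:E3) R, q 1 x = volume.real (ball (0:E3) R) := by
    simp only [hx]
    rw [integral_add, integral_add, integral_add]
    · simp only [integral_const_mul]
      rw [k0.2, k1.2, k2.2, k3.2]
      linear_combination (volume.real (ball (0:E3) R)) * hsum
    · exact k0.1.const_mul _
    · exact k1.1.const_mul _
    · exact (k0.1.const_mul _).add (k1.1.const_mul _)
    · exact k2.1.const_mul _
    · exact ((k0.1.const_mul _).add (k1.1.const_mul _)).add (k2.1.const_mul _)
    · exact k3.1.const_mul _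
  have hI0 : ∫ x in ball (0:E3) R, q 1 x = 0 := by
    rw [setIntegral_congr_fun (g := fun _ => (0:ℝ)) measurableSet_ball]
    · simp
    · intro x hx; simpa [hq] using hdet x hx
  rw [hI0] at hI
  have : 0 < volume.real (ball (0:E3) R) := by
    rw [Measure.real, ENNReal.toReal_pos_iff]
    exact ⟨measure_ball_pos _ _ hR, measure_ball_lt_top⟩
  linarith

lemma id_smooth (F : E3 → E3) (hF : ContDiff ℝ 1 F) (hout : ∀ x, 1 ≤ ‖x‖ → F x = x)
    (hne : ∀ x, F x ≠ 0) : False := by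
  let n : E3 → E3 := fun x => ‖F x‖⁻¹ • F x
  have hn : ContDiff ℝ 1 n :=
    ((hF.norm ℝ hne).inv (fun x => norm_ne_zero_iff.2 (hne x))).smul hF
  have hn1 : ∀ x, ‖n x‖ = 1 := fun x => by
    simp only [n, norm_smul, norm_inv, norm_norm]
    exact inv_mul_cancel₀ (norm_ne_zero_iff.2 (hne x))
  obtain ⟨Cn, hCn⟩ := (hn.contDiffOn (s := closedBall (0:E3) 1)).exists_lipschitzOnWith one_ne_zero
    (convex_closedBall _ _) (isCompact_closedBall _ _)
  let H : E3 → E3 := fun x => if ‖x‖ ≤ 1 then n x - x else 0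
  have hH0 : ∀ x, 1 ≤ ‖x‖ → H x = 0 := by
    intro x hx
    simp only [H]
    split_ifs with h
    · have h1 : ‖x‖ = 1 := le_antisymm h hx
      simp [n, hout x hx, h1]
    · rfl
  have hin : ∀ x y, ‖x‖ ≤ 1 → ‖y‖ ≤ 1 → ‖H x - H y‖ ≤ (Cn + 1) * ‖x - y‖ := by
    intro x y hx hy
    simp only [H, if_pos hx, if_pos hy]
    have h1 : ‖n x - n y‖ ≤ Cn * ‖x - y‖ := by
      simpa [dist_eq_norm] using hCn.dist_le_mul x (by simpa using hx) y (by simpa using hy)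
    calc ‖n x - x - (n y - y)‖ = ‖(n x - n y) - (x - y)‖ := by congr 1; abel
      _ ≤ ‖n x - n y‖ + ‖x - y‖ := norm_sub_le _ _
      _ ≤ _ := by linarith
  have hmix : ∀ x y, ‖x‖ ≤ 1 → 1 ≤ ‖y‖ → ‖H x - H y‖ ≤ (2 * (Cn + 1)) * ‖x - y‖ := by
    intro x y hx hy
    have hy0 : ‖y‖ ≠ 0 := by linarith
    let z : E3 := ‖y‖⁻¹ • y
    have hz : ‖z‖ = 1 := by simp [z, norm_smul, hy0]
    have hzy : ‖z - y‖ ≤ ‖x - y‖ := by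
      have : z - y = (‖y‖⁻¹ - 1) • y := by simp [z, sub_smul]
      rw [this, norm_smul, Real.norm_of_nonpos (by
        have := inv_le_one_of_one_le₀ hy; linarith)]
      have h3 : -(‖y‖⁻¹ - 1) * ‖y‖ = ‖y‖ - 1 := by field_simp; ring
      rw [h3]
      have := norm_sub_norm_le y x
      rw [norm_sub_rev] at this
      linarith
    have h1 := hin x z hx hz.le
    rw [hH0 z hz.ge] at h1
    rw [hH0 y hy]
    have h2 : ‖x - z‖ ≤ 2 * ‖x - y‖ := by
      have : x - z = (x - y) - (z - y) := by abel
      rw [this]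
      have := norm_sub_le (x - y) (z - y)
      linarith
    have : (0:ℝ) ≤ Cn := Cn.2
    nlinarith
  have hLip : LipschitzWith (2 * (Cn + 1)) H := by
    apply LipschitzWith.of_dist_le_mul
    intro x y
    rw [dist_eq_norm, dist_eq_norm]
    push_cast
    have hC : (0:ℝ) ≤ Cn := Cn.2
    rcases le_total ‖x‖ 1 with hx | hx
    · rcases le_total ‖y‖ 1 with hy | hy
      · have := hin x y hx hy
        nlinarith [norm_nonneg (x - y)]
      · exact hmix x y hx hy
    · rcases le_total ‖y‖ 1 with hy | hy
      · rw [norm_sub_rev, norm_sub_rev x y]; exact hmix y x hy hx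
      · rw [hH0 x hx, hH0 y hy]; simp; positivity
  have hder : ∀ x ∈ ball (0:E3) 1, HasFDerivAt H (fderiv ℝ n x - ContinuousLinearMap.id ℝ E3) x := by
    intro x hx
    have h1 : HasFDerivAt (fun x => n x - x) (fderiv ℝ n x - ContinuousLinearMap.id ℝ E3) x :=
      ((hn.differentiable one_ne_zero x).hasFDerivAt).sub (hasFDerivAt_id x)
    apply h1.congr_of_eventuallyEq
    filter_upwards [isOpen_ball.mem_nhds hx] with y hy
    have : ‖y‖ ≤ 1 := by simpa using (mem_ball.1 hy).le
    simp [H, this]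
  refine id_nodet H _ hLip 1 one_pos hH0 (fun x hx => (hder x hx).differentiableAt) ?_
  intro x hx
  rw [(hder x hx).fderiv]
  have : ContinuousLinearMap.id ℝ E3 + (fderiv ℝ n x - ContinuousLinearMap.id ℝ E3) = fderiv ℝ n x := by
    abel
  rw [this]
  by_contra hdet
  have hsurj : Function.Surjective (fderiv ℝ n x) := by
    have hu : IsUnit (LinearMap.det (fderiv ℝ n x : E3 →ₗ[ℝ] E3)) := isUnit_iff_ne_zero.2 hdet
    have := LinearMap.equivOfDetNeZero (fderiv ℝ n x : E3 →ₗ[ℝ] E3) hdet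
    intro y
    refine ⟨(LinearMap.equivOfDetNeZero (fderiv ℝ n x : E3 →ₗ[ℝ] E3) hdet).symm y, ?_⟩
    exact (LinearMap.equivOfDetNeZero (fderiv ℝ n x : E3 →ₗ[ℝ] E3) hdet).apply_symm_apply y
  obtain ⟨v, hv⟩ := hsurj (n x)
  have hnd := (hn.differentiable one_ne_zero x).hasFDerivAt
  have h1 := hnd.inner ℝ hnd
  have h2 : HasFDerivAt (fun y => inner ℝ (n y) (n y)) (0 : E3 →L[ℝ] ℝ) x := by
    have : (fun y => inner ℝ (n y) (n y)) = fun _ => (1:ℝ) := by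
      funext y; rw [real_inner_self_eq_norm_sq, hn1]; norm_num
    rw [this]; exact hasFDerivAt_const _ _
  have h3 := congrArg (fun B : E3 →L[ℝ] ℝ => B v) (h1.unique h2)
  simp [hv] at h3
  have h4 := hn1 x
  rw [h3] at h4
  simp at h4

lemma id_zero (H : E3 → E3) (hH : Continuous H) (hnear : ∀ x, ‖x‖ ≤ 1 → ‖H x - x‖ ≤ 1/4) :
    ∃ x, ‖x‖ ≤ 1 ∧ H x = 0 := by
  by_contra hcon
  push Not at hcon
  let χ : E3 → ℝ := fun x => max 0 (min 1 (3 - 4 * ‖x‖))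
  have hχ : Continuous χ := by fun_prop
  have hχ0 : ∀ x, 0 ≤ χ x := fun x => le_max_left _ _
  have hχ1 : ∀ x, χ x ≤ 1 := fun x => max_le zero_le_one (min_le_left _ _)
  have hχa : ∀ x, ‖x‖ ≤ 1/2 → χ x = 1 := fun x hx => by
    simp only [χ]; rw [min_eq_left (by linarith)]; norm_num
  have hχb : ∀ x, 3/4 ≤ ‖x‖ → χ x = 0 := fun x hx => by
    simp only [χ]; apply max_eq_left; exact (min_le_right _ _).trans (by linarith)
  let F0 : E3 → E3 := fun x => x + χ x • (H x - x)
  have hF0 : Continuous F0 := by fun_prop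
  have hne : ∀ x, F0 x ≠ 0 := by
    intro x h0
    rcases le_total ‖x‖ (1/2) with hx | hx
    · simp only [F0, hχa x hx, one_smul, add_sub_cancel] at h0
      exact hcon x (by linarith) h0
    · rcases le_total ‖x‖ (3/4) with hx' | hx'
      · have h1 : x = -(χ x • (H x - x)) := eq_neg_of_add_eq_zero_left h0
        have h2 : ‖x‖ ≤ 1/4 := by
          rw [h1, norm_neg, norm_smul, Real.norm_of_nonneg (hχ0 x)]
          have := hnear x (by linarith)
          have := hχ1 x
          nlinarith [norm_nonneg (H x - x), hχ0 x]
        linarith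
      · simp only [F0, hχb x hx', zero_smul, add_zero] at h0
        rw [h0] at hx'; norm_num at hx'
  obtain ⟨g, hg, hgd, hge, -⟩ := hF0.exists_contDiff_approx_and_eqOn (1:ℕ∞) (ε := fun x => ‖F0 x‖)
    hF0.norm (fun x => norm_pos_iff.2 (hne x)) (S := {x | 1 ≤ ‖x‖}) (U := {x | 3/4 < ‖x‖})
    (isClosed_le continuous_const continuous_norm)
    ((isOpen_lt continuous_const continuous_norm).mem_nhdsSet.2 (fun x hx => by
      have : (1:ℝ) ≤ ‖x‖ := hx
      show (3/4:ℝ) < ‖x‖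
      linarith))
    (by
      apply contDiffOn_id.congr
      intro x hx
      simp [F0, hχb x (le_of_lt hx)])
  refine id_smooth g hg ?_ ?_
  · intro x hx
    rw [hge hx]
    simp [F0, hχb x (by linarith)]
  · intro x h0
    have := hgd x
    rw [h0, dist_eq_norm] at this
    simp at this

end InvDom

section InvDom2
open MeasureTheory Metric

lemma inv_dom_ball (f : E3 → E3) (hf : ContinuousOn f (closedBall 0 1))
    (hinj : InjOn f (closedBall 0 1)) : f 0 ∈ interior (f '' closedBall 0 1) := by
  by_contra hcon
  set B : Set E3 := closedBall 0 1 with hB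
  have hBc : IsCompact B := isCompact_closedBall _ _
  have h0B : (0:E3) ∈ B := by simp [hB]
  have : CompactSpace B := isCompact_iff_compactSpace.1 hBc
  have hemb : IsClosedEmbedding (B.domRestrict f) :=
    (continuousOn_iff_continuous_domRestrict.1 hf).isClosedEmbedding (injOn_iff_injective.1 hinj)
  obtain ⟨G, hG⟩ := ContinuousMap.exists_extension hemb (⟨Subtype.val, continuous_subtype_val⟩ : C(B, E3))
  have hGf : ∀ x ∈ B, G (f x) = x := fun x hx => congrArg (fun k : C(B, E3) => k ⟨x, hx⟩) hG
  set Q : Set E3 := f '' B with hQ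
  have hQc : IsCompact Q := hBc.image_of_continuousOn hf
  -- epsilon
  obtain ⟨ε, hε, hεG⟩ : ∃ ε > 0, ∀ y, dist y (f 0) ≤ 2 * ε → ‖G y‖ ≤ 1/10 := by
    have h1 : ∀ᶠ y in 𝓝 (f 0), ‖G y‖ < 1/10 := by
      have : ContinuousAt (fun y => ‖G y‖) (f 0) := by fun_prop
      apply this.eventually_lt_const
      show ‖G (f 0)‖ < 1/10
      rw [hGf 0 h0B]; norm_num
    obtain ⟨η, hη, h2⟩ := Metric.eventually_nhds_iff.1 h1
    exact ⟨η / 4, by positivity, fun y hy => (h2 (by linarith)).le⟩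
  obtain ⟨c, hcQ, hcd⟩ : ∃ c, c ∉ Q ∧ dist c (f 0) < ε := by
    by_contra h
    push Not at h
    apply hcon
    rw [mem_interior_iff_mem_nhds]
    filter_upwards [ball_mem_nhds (f 0) hε] with y hy
    by_contra hyQ
    exact absurd hy (by simpa using h y hyQ)
  have hne : ∀ y ∈ Q, ‖y - c‖ ≠ 0 := fun y hy h => hcQ (by
    rw [norm_eq_zero, sub_eq_zero] at h; rwa [← h])
  -- delta
  obtain ⟨δ, hδ, hδ2, hδG⟩ : ∃ δ > 0, δ ≤ 1/20 ∧ ∀ y ∈ Q, ε ≤ ‖y - c‖ → δ ≤ ‖G y‖ := by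
    have hSg : IsCompact (Q ∩ {y | ε ≤ ‖y - c‖}) :=
      hQc.inter_right (isClosed_le continuous_const (by fun_prop))
    have hpos : ∀ y ∈ Q ∩ {y | ε ≤ ‖y - c‖}, 0 < ‖G y‖ := by
      rintro y ⟨⟨x, hx, rfl⟩, hy⟩
      rw [hGf x hx, norm_pos_iff]
      rintro rfl
      simp only [mem_setOf_eq] at hy
      rw [dist_eq_norm, norm_sub_rev] at hcd
      linarith
    obtain ⟨d, hd, hdle⟩ := hSg.exists_forall_le' (f := fun y => ‖G y‖) (by fun_prop) hpos
    exact ⟨min d (1/20), by positivity, min_le_right _ _, fun y hy hy' =>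
      (min_le_left _ _).trans (hdle y ⟨hy, hy'⟩)⟩
  obtain ⟨g, hg, hgd, -⟩ := G.continuous.exists_contDiff_approx (1:ℕ∞) (ε := fun _ => δ/2)
    continuous_const (fun _ => by positivity)
  obtain ⟨v, hv, hvg⟩ : ∃ v, ‖v‖ < δ/2 ∧ v ∉ g '' sphere c ε := by
    by_contra h
    push Not at h
    have hz : volume (g '' sphere c ε) = 0 := by
      apply addHaar_image_eq_zero_of_differentiableOn_of_addHaar_eq_zero
      · exact (hg.differentiable one_ne_zero).differentiableOn
      · exact Measure.addHaar_sphere_of_ne_zero _ _ hε.ne'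
    have h2 : volume (ball (0:E3) (δ/2)) = 0 := measure_mono_null (fun v hv => h v (by simpa using hv)) hz
    exact (measure_ball_pos volume (0:E3) (by positivity : 0 < δ/2)).ne' h2
  let P : E3 → E3 := fun y => g y - v
  have hPc : Continuous P := hg.continuous.sub continuous_const
  have hPG : ∀ y, ‖P y - G y‖ < δ := by
    intro y
    have h1 := hgd y
    rw [dist_eq_norm] at h1
    have : P y - G y = (g y - G y) - v := by simp only [P]; abel
    rw [this]
    have := norm_sub_le (g y - G y) v
    linarith
  let Φ : E3 → E3 := fun y => c + (max (ε / ‖y - c‖) 1) • (y - c)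
  have hΦ1 : ∀ y ∈ Q, ε ≤ ‖y - c‖ → Φ y = y := by
    intro y hy h
    have : ε / ‖y - c‖ ≤ 1 := by rw [div_le_one (by linarith)]; exact h
    simp [Φ, max_eq_right this]
  have hΦ2 : ∀ y ∈ Q, ‖y - c‖ ≤ ε → ‖Φ y - c‖ = ε := by
    intro y hy h
    have hn := hne y hy
    have hp : 0 < ‖y - c‖ := lt_of_le_of_ne (norm_nonneg _) hn.symm
    have : 1 ≤ ε / ‖y - c‖ := by rw [le_div_iff₀ hp]; linarith
    simp only [Φ, max_eq_left this, add_sub_cancel_left, norm_smul, Real.norm_of_nonneg (by linarith : (0:ℝ) ≤ ε / ‖y - c‖)]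
    field_simp
  have hΦc : ContinuousOn Φ Q := by
    apply continuousOn_const.add
    have h1 : ContinuousOn (fun y => ε / ‖y - c‖) Q :=
      ContinuousOn.div continuousOn_const (by fun_prop) hne
    have h2 : ContinuousOn (fun y => max (ε / ‖y - c‖) 1) Q :=
      ContinuousOn.sup h1 continuousOn_const
    exact h2.smul (by fun_prop : ContinuousOn (fun y => y - c) Q)
  have hPΦ : ∀ y ∈ Q, P (Φ y) ≠ 0 := by
    intro y hy h0
    rcases le_total ε ‖y - c‖ with h | h
    · rw [hΦ1 y hy h] at h0
      have h1 := hδG y hy h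
      have h2 := hPG y
      rw [h0, zero_sub, norm_neg] at h2
      linarith
    · apply hvg
      refine ⟨Φ y, ?_, ?_⟩
      · rw [mem_sphere, dist_eq_norm]; exact hΦ2 y hy h
      · exact sub_eq_zero.1 h0
  let pr : E3 → E3 := fun x => (max 1 ‖x‖)⁻¹ • x
  have hpr : Continuous pr := by
    have h1 : Continuous (fun x : E3 => (max 1 ‖x‖)⁻¹) :=
      (continuous_const.max continuous_norm).inv₀ (fun x => by
        have := le_max_left 1 ‖x‖; positivity)
    exact h1.smul continuous_id
  have hprB : ∀ x, pr x ∈ B := by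
    intro x
    have h1 := le_max_left 1 ‖x‖
    have h2 := le_max_right 1 ‖x‖
    simp only [hB, mem_closedBall, dist_zero_right, pr, norm_smul, norm_inv]
    rw [Real.norm_of_nonneg (by linarith), inv_mul_le_one₀ (by linarith)]
    exact h2
  have hprid : ∀ x, ‖x‖ ≤ 1 → pr x = x := fun x hx => by simp [pr, max_eq_left hx]
  have hcont : Continuous fun x => P (Φ (f (pr x))) := by
    have h1 : Continuous (fun x => f (pr x)) := hf.comp_continuous hpr hprB
    exact hPc.comp (hΦc.comp_continuous h1 (fun x => mem_image_of_mem f (hprB x)))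
  obtain ⟨x, hx, hx0⟩ := id_zero (fun x => P (Φ (f (pr x)))) hcont (by
    intro x hx
    have hxB : x ∈ B := by simpa [hB] using hx
    simp only [hprid x hx]
    have hyQ : f x ∈ Q := mem_image_of_mem f hxB
    rcases le_total ε ‖f x - c‖ with h | h
    · rw [hΦ1 _ hyQ h]
      have := hPG (f x)
      rw [hGf x hxB] at this
      linarith
    · have h1 := hPG (Φ (f x))
      have hcd' : ‖c - f 0‖ < ε := by rwa [dist_eq_norm] at hcd
      have h2 : ‖G (Φ (f x))‖ ≤ 1/10 := by
        apply hεG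
        rw [dist_eq_norm]
        have h3 := hΦ2 _ hyQ h
        have : Φ (f x) - f 0 = (Φ (f x) - c) + (c - f 0) := by abel
        rw [this]
        have := norm_add_le (Φ (f x) - c) (c - f 0)
        linarith
      have h4 : ‖x‖ ≤ 1/10 := by
        rw [← hGf x hxB]
        apply hεG
        rw [dist_eq_norm]
        have : f x - f 0 = (f x - c) + (c - f 0) := by abel
        rw [this]
        have := norm_add_le (f x - c) (c - f 0)
        linarith
      have : P (Φ (f x)) - x = (P (Φ (f x)) - G (Φ (f x))) + G (Φ (f x)) - x := by abel
      rw [this]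
      have h5 := norm_sub_le ((P (Φ (f x)) - G (Φ (f x))) + G (Φ (f x))) x
      have h6 := norm_add_le (P (Φ (f x)) - G (Φ (f x))) (G (Φ (f x)))
      linarith)
  exact hPΦ _ (mem_image_of_mem f (hprB x)) hx0

lemma inv_dom (f : E3 → E3) (U : Set E3) (hU : IsOpen U) (hf : ContinuousOn f U)
    (hinj : InjOn f U) : IsOpen (f '' U) := by
  rw [isOpen_iff_mem_nhds]
  rintro _ ⟨x, hx, rfl⟩
  obtain ⟨r, hr, hrU⟩ := Metric.nhds_basis_closedBall.mem_iff.1 (hU.mem_nhds hx)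
  let s : E3 → E3 := fun z => x + r • z
  have hs : MapsTo s (closedBall 0 1) (closedBall x r) := by
    intro z hz
    simp only [mem_closedBall, dist_zero_right] at hz
    simp only [s, mem_closedBall, dist_eq_norm, add_sub_cancel_left, norm_smul, Real.norm_of_nonneg hr.le]
    nlinarith
  have := inv_dom_ball (f ∘ s) ((hf.mono hrU).comp (by fun_prop) hs) (by
    apply (hinj.mono hrU).comp _ hs
    intro a _ b _ h
    simpa [s, hr.ne'] using h)
  rw [mem_interior_iff_mem_nhds] at this
  have h1 : (f ∘ s) 0 = f x := by simp [s]
  rw [h1] at this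
  apply Filter.mem_of_superset this
  rintro _ ⟨z, hz, rfl⟩
  exact ⟨s z, hrU (hs hz), rfl⟩

lemma inv_dom_sub (U : Set E3) (hU : IsOpen U) (k : U → E3) (hk : Continuous k)
    (hinj : Function.Injective k) : IsOpen (range k) := by
  let f : E3 → E3 := Function.extend Subtype.val k 0
  have hfk : ∀ u : U, f u = k u := fun u => Subtype.val_injective.extend_apply _ _ _
  have := inv_dom f U hU (by
    rw [continuousOn_iff_continuous_domRestrict]
    convert hk using 1
    funext u; exact hfk u) (by
    intro a ha b hb h
    have h1 := hfk ⟨a, ha⟩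
    have h2 := hfk ⟨b, hb⟩
    simp only at h1 h2
    rw [h1, h2] at h
    exact congrArg Subtype.val (hinj h))
  convert this using 1
  ext y
  constructor
  · rintro ⟨u, rfl⟩; exact ⟨u, u.2, hfk u⟩
  · rintro ⟨u, hu, rfl⟩; exact ⟨⟨u, hu⟩, (hfk ⟨u, hu⟩).symm⟩

end InvDom2

section MfldID

lemma mfld_open {M : Type*} [TopologicalSpace M] (hM : LocallyEuclidean 3 M)
    (U : Set E3) (hU : IsOpen U) (h : U → M) (hc : Continuous h) (hinj : Function.Injective h) :
    IsOpen (range h) := by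
  rw [isOpen_iff_mem_nhds]
  rintro _ ⟨u, rfl⟩
  obtain ⟨W, hW, hmem, UW, hUW, ⟨φ⟩⟩ := hM (h u)
  have hU' : IsOpen (Subtype.val '' (h ⁻¹' W) : Set E3) :=
    hU.isOpenMap_subtype_val _ (hW.preimage hc)
  have hp : ∀ p : ↥(Subtype.val '' (h ⁻¹' W) : Set E3), ∃ hp : (p : E3) ∈ U, h ⟨p, hp⟩ ∈ W := by
    rintro ⟨_, ⟨q, hq, rfl⟩⟩
    exact ⟨q.2, hq⟩
  choose hpU hpW using hp
  let k : ↥(Subtype.val '' (h ⁻¹' W) : Set E3) → E3 := fun p => (φ ⟨h ⟨p, hpU p⟩, hpW p⟩ : E3)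
  have hk : Continuous k := by
    apply continuous_subtype_val.comp
    apply φ.continuous.comp
    apply Continuous.subtype_mk
    exact hc.comp (Continuous.subtype_mk continuous_subtype_val _)
  have hkinj : Function.Injective k := by
    intro p q hpq
    have h1 := φ.injective (Subtype.val_injective hpq)
    have h2 := hinj (congrArg Subtype.val h1)
    exact Subtype.ext (congrArg (Subtype.val : U → E3) h2)
  have ho := inv_dom_sub _ hU' k hk hkinj
  have ho2 : IsOpen (Subtype.val '' (φ ⁻¹' (Subtype.val ⁻¹' range k)) : Set M) :=
    hW.isOpenMap_subtype_val _ ((ho.preimage continuous_subtype_val).preimage φ.continuous)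
  apply Filter.mem_of_superset (ho2.mem_nhds _)
  · rintro _ ⟨w, ⟨p, hp⟩, rfl⟩
    have := φ.injective (Subtype.val_injective hp)
    exact ⟨⟨p, hpU p⟩, congrArg Subtype.val this⟩
  · refine ⟨⟨h u, hmem⟩, ⟨⟨u, ⟨u, hmem, rfl⟩⟩, ?_⟩, rfl⟩
    rfl

lemma bdry_eq {M : Type*} [TopologicalSpace M] (hM : LocallyEuclidean 3 M) (C : Set M) :
    subsetBoundary 3 C = C \ interior C := by
  ext x
  constructor
  · rintro ⟨⟨x, hxC⟩, hx, rfl⟩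
    refine ⟨hxC, fun hi => hx ?_⟩
    obtain ⟨W, hW, hmem, UW, hUW, ⟨φ⟩⟩ := hM x
    let V : Set C := Subtype.val ⁻¹' (W ∩ interior C)
    refine ⟨V, (hW.inter isOpen_interior).preimage continuous_subtype_val, ⟨hmem, hi⟩, ?_⟩
    let U : Set E3 := Subtype.val '' (φ.symm ⁻¹' (Subtype.val ⁻¹' interior C))
    refine ⟨U, hUW.isOpenMap_subtype_val _ ((isOpen_interior.preimage continuous_subtype_val).preimage φ.symm.continuous), ?_⟩
    have hU : ∀ u : U, ∃ h : (u:E3) ∈ UW, (φ.symm ⟨u, h⟩ : M) ∈ interior C := by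
      rintro ⟨_, ⟨q, hq, rfl⟩⟩
      exact ⟨q.2, hq⟩
    choose hU1 hU2 using hU
    refine ⟨{
      toFun := fun v => ⟨φ ⟨v.1, v.2.1⟩, ⟨φ ⟨v.1, v.2.1⟩, by
        simp only [mem_preimage, φ.symm_apply_apply]; exact v.2.2, rfl⟩⟩
      invFun := fun u => ⟨⟨φ.symm ⟨u, hU1 u⟩, interior_subset (hU2 u)⟩, ⟨(φ.symm ⟨u, hU1 u⟩).2, hU2 u⟩⟩
      left_inv := fun v => by apply Subtype.ext; apply Subtype.ext; simp
      right_inv := fun u => by apply Subtype.ext; simp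
      continuous_toFun := ?_
      continuous_invFun := ?_ }⟩
    · apply Continuous.subtype_mk
      apply continuous_subtype_val.comp
      apply φ.continuous.comp
      apply Continuous.subtype_mk
      exact continuous_subtype_val.comp continuous_subtype_val
    · apply Continuous.subtype_mk
      apply Continuous.subtype_mk
      apply continuous_subtype_val.comp
      apply φ.symm.continuous.comp
      exact Continuous.subtype_mk continuous_subtype_val _
  · rintro ⟨hxC, hx⟩
    refine ⟨⟨x, hxC⟩, ?_, rfl⟩
    rintro ⟨V, hV, hxV, U, hU, ⟨φ⟩⟩
    apply hx
    have := mfld_open hM U hU (fun u => ((φ.symm u : C) : M))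
      (by fun_prop)
      (fun u v h => φ.symm.injective (Subtype.val_injective (Subtype.val_injective h)))
    refine mem_interior.2 ⟨_, ?_, this, ⟨φ ⟨_, hxV⟩, by simp⟩⟩
    rintro _ ⟨u, rfl⟩
    exact ((φ.symm u : V) : C).2

/-- linear identification of the product with three-space -/
noncomputable def psi3 : (EuclideanSpace ℝ (Fin 2) × ℝ) ≃L[ℝ] E3 :=
  ContinuousLinearEquiv.ofFinrankEq (by simp)

/-- `t > 0` in a half-space chart means interior. -/
lemma chart_pos {M : Type*} [TopologicalSpace M] (hM : LocallyEuclidean 3 M) (K : Set M)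
    (V : Set K) (U : Set (HalfSpace 3)) (hU : IsOpen U) (φ : V ≃ₜ U)
    (v : V) (hv : 0 < ((φ v : HalfSpace 3).2 : ℝ)) : ((v : K) : M) ∈ interior K := by
  let W : Set E3 := {w | 0 < (psi3.symm w).2 ∧
    (((psi3.symm w).1, ⟨max 0 (psi3.symm w).2, le_max_left _ _⟩) : HalfSpace 3) ∈ U}
  have hW : IsOpen W := by
    apply IsOpen.inter
    · exact isOpen_lt (f := fun _ : E3 => (0:ℝ)) (g := fun w : E3 => (psi3.symm w).2) continuous_const (by fun_prop)
    · apply hU.preimage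
      apply Continuous.prodMk (by fun_prop)
      apply Continuous.subtype_mk
      fun_prop
  have := mfld_open hM W hW (fun w => ((φ.symm ⟨_, w.2.2⟩ : K) : M)) (by
      apply continuous_subtype_val.comp
      apply continuous_subtype_val.comp
      apply φ.symm.continuous.comp
      apply Continuous.subtype_mk
      apply Continuous.prodMk (by fun_prop)
      apply Continuous.subtype_mk
      fun_prop) (by
      intro a b hab
      have h1 := φ.symm.injective (Subtype.val_injective (Subtype.val_injective hab))
      have h2 := congrArg Subtype.val h1
      simp only [Prod.mk.injEq, Subtype.mk.injEq] at h2
      rw [max_eq_right a.2.1.le, max_eq_right b.2.1.le] at h2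
      exact Subtype.ext (psi3.symm.injective (Prod.ext h2.1 h2.2)))
  refine mem_interior.2 ⟨_, ?_, this, ?_⟩
  · rintro _ ⟨u, rfl⟩
    exact (φ.symm _ : K).2
  · have e : (((psi3.symm (psi3 ((φ v : HalfSpace 3).1, ((φ v : HalfSpace 3).2:ℝ)))).1, ⟨max 0 (psi3.symm (psi3 ((φ v : HalfSpace 3).1, ((φ v : HalfSpace 3).2:ℝ)))).2, le_max_left _ _⟩) : HalfSpace 3) = (φ v : HalfSpace 3) := by
      apply Prod.ext
      · simp
      · apply Subtype.ext
        simp [hv.le]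
    refine ⟨⟨psi3 ((φ v : HalfSpace 3).1, ((φ v : HalfSpace 3).2:ℝ)), ?_, ?_⟩, ?_⟩
    · simpa using hv
    · rw [e]; exact (φ v).2
    · simp only [e]
      simp

lemma chart_zero {M : Type*} [TopologicalSpace M] (hM : LocallyEuclidean 3 M) (K : Set M)
    (V : Set K) (hV : IsOpen V) (U : Set (HalfSpace 3)) (φ : V ≃ₜ U)
    (v : V) (hv : ((φ v : HalfSpace 3).2 : ℝ) = 0) : ((v : K) : M) ∉ interior K := by
  intro hi
  obtain ⟨O, hO, rfl⟩ := isOpen_induced_iff.1 hV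
  obtain ⟨W, hW, hmem, UW, hUW, ⟨χ⟩⟩ := hM ((v : K) : M)
  let U' : Set E3 := Subtype.val '' (χ.symm ⁻¹' (Subtype.val ⁻¹' (O ∩ interior K)))
  have hU' : IsOpen U' := hUW.isOpenMap_subtype_val _
    (((hO.inter isOpen_interior).preimage continuous_subtype_val).preimage χ.symm.continuous)
  have hU : ∀ u : U', ∃ h : (u:E3) ∈ UW, (χ.symm ⟨u, h⟩ : M) ∈ O ∩ interior K := by
    rintro ⟨_, ⟨q, hq, rfl⟩⟩
    exact ⟨q.2, hq⟩
  choose hU1 hU2 using hU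
  let g : U' → HalfSpace 3 := fun u => φ ⟨⟨χ.symm ⟨u, hU1 u⟩, interior_subset (hU2 u).2⟩, (hU2 u).1⟩
  have hg : Continuous g := by
    apply continuous_subtype_val.comp
    apply φ.continuous.comp
    apply Continuous.subtype_mk
    apply Continuous.subtype_mk
    apply continuous_subtype_val.comp
    apply χ.symm.continuous.comp
    exact Continuous.subtype_mk continuous_subtype_val _
  have hginj : Function.Injective g := by
    intro a b hab
    have h1 := congrArg Subtype.val (congrArg Subtype.val (φ.injective (Subtype.val_injective hab)))
    have h2 := congrArg Subtype.val (χ.symm.injective (Subtype.val_injective h1))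
    exact Subtype.ext h2
  have ho := inv_dom_sub U' hU' (fun u => psi3 ((g u).1, ((g u).2 : ℝ))) (by fun_prop) (by
    intro a b hab
    have h := psi3.injective hab
    simp only [Prod.mk.injEq] at h
    exact hginj (Prod.ext h.1 (Subtype.ext h.2)))
  have ho2 := ho.preimage psi3.continuous
  let u0 : U' := ⟨χ ⟨_, hmem⟩, ⟨χ ⟨_, hmem⟩, by simpa using ⟨v.2, hi⟩, rfl⟩⟩
  have hg0 : g u0 = φ v := by
    have : (⟨⟨χ.symm ⟨u0, hU1 u0⟩, interior_subset (hU2 u0).2⟩, (hU2 u0).1⟩ : ↥(Subtype.val ⁻¹' O : Set K)) = v := by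
      apply Subtype.ext; apply Subtype.ext; simp [u0]
    simp only [g]
    rw [this]
  have hm : ((φ v : HalfSpace 3).1, (0:ℝ)) ∈ psi3 ⁻¹' (range fun u => psi3 ((g u).1, ((g u).2 : ℝ))) :=
    ⟨u0, by simp only [hg0]; rw [hv]⟩
  have hcont : Continuous (fun t : ℝ => ((φ v : HalfSpace 3).1, t)) := by fun_prop
  have ho3 := ho2.preimage hcont
  obtain ⟨ε, hε, hb⟩ := Metric.isOpen_iff.1 ho3 0 hm
  have : (-(ε/2)) ∈ Metric.ball (0:ℝ) ε := by
    rw [Metric.mem_ball, Real.dist_eq]; simp only [sub_zero, abs_neg]; rw [abs_of_pos (by positivity)]; linarith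
  obtain ⟨u, hu⟩ := hb this
  have h := congrArg Prod.snd (psi3.injective hu)
  simp only at h
  have := (g u).2.2
  linarith

end MfldID

section Bicollar

/-- collar coordinates in an ambient space -/
structure CollarData (M S : Type*) [TopologicalSpace M] [TopologicalSpace S] where
  τ : M → ℝ
  c : S × ℝ → M
  p : M → S
  hτ : Continuous τ
  hc : ContinuousOn c (univ ×ˢ Ioo 0 1)
  hp : ContinuousOn p (τ ⁻¹' Ioo 0 1)
  τc : ∀ x t, t ∈ Ioo (0:ℝ) 1 → τ (c (x, t)) = t
  pc : ∀ x t, t ∈ Ioo (0:ℝ) 1 → p (c (x, t)) = x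
  cp : ∀ m, τ m ∈ Ioo (0:ℝ) 1 → c (p m, τ m) = m

lemma S_closure {M : Type*} [TopologicalSpace M] (hM : LocallyEuclidean 3 M) (K : Set M)
    (hK : LocallyHalfSpace 3 ↥K) : K ⊆ closure (interior K) := by
  intro x hx
  obtain ⟨V, hV, hxV, U, hU, ⟨φ⟩⟩ := hK ⟨x, hx⟩
  by_cases h0 : 0 < ((φ ⟨_, hxV⟩ : HalfSpace 3).2 : ℝ)
  · exact subset_closure (chart_pos hM K V U hU φ _ h0)
  rw [mem_closure_iff]
  intro O hO hxO
  set u0 := φ ⟨_, hxV⟩ with hu0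
  let g : ℝ → HalfSpace 3 := fun t => ((u0 : HalfSpace 3).1, ⟨max 0 t, le_max_left _ _⟩)
  have hg : Continuous g := by
    apply Continuous.prodMk (by fun_prop)
    apply Continuous.subtype_mk
    fun_prop
  have hg0 : g 0 = u0 := by
    apply Prod.ext
    · rfl
    · apply Subtype.ext
      have := (u0 : HalfSpace 3).2.2
      simp only [g, max_self]
      linarith
  have hO' : IsOpen (Subtype.val '' (φ.symm ⁻¹' (Subtype.val ⁻¹' (Subtype.val ⁻¹' O))) : Set (HalfSpace 3)) :=
    hU.isOpenMap_subtype_val _ (((hO.preimage continuous_subtype_val).preimage continuous_subtype_val).preimage φ.symm.continuous)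
  have hmem : (0:ℝ) ∈ g ⁻¹' (Subtype.val '' (φ.symm ⁻¹' (Subtype.val ⁻¹' (Subtype.val ⁻¹' O))) : Set (HalfSpace 3)) := by
    rw [mem_preimage, hg0]
    exact ⟨u0, by simpa [hu0] using hxO, rfl⟩
  obtain ⟨ε, hε, hb⟩ := Metric.isOpen_iff.1 (hO'.preimage hg) 0 hmem
  have : (ε/2) ∈ Metric.ball (0:ℝ) ε := by
    rw [Metric.mem_ball, Real.dist_eq]; simp only [sub_zero]; rw [abs_of_pos (by positivity)]; linarith
  obtain ⟨u, hu, hug⟩ := hb this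
  refine ⟨((φ.symm u : K) : M), hu, ?_⟩
  apply chart_pos hM K V U hU φ
  rw [φ.apply_symm_apply, hug]
  simp only [g]
  exact lt_max_of_lt_right (by positivity)

lemma bicollar_open {M : Type*} [TopologicalSpace M] (hM : LocallyEuclidean 3 M) (K : Set M)
    (hK : LocallyHalfSpace 3 ↥K)
    (b : ↥(subsetBoundary 3 K) × ↥(Set.Icc (-1 : ℝ) 1) → M) (hb : Topology.IsEmbedding b) :
    IsOpen (b '' {q | -1 < (q.2:ℝ) ∧ (q.2:ℝ) < 1}) := by
  rw [isOpen_iff_mem_nhds]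
  rintro _ ⟨⟨⟨x, hx⟩, t0⟩, ht0, rfl⟩
  have hx' := hx
  rw [bdry_eq hM] at hx'
  obtain ⟨V, hV, hxV, U, hU, ⟨φ⟩⟩ := hK ⟨x, hx'.1⟩
  have h0 : ((φ ⟨_, hxV⟩ : HalfSpace 3).2 : ℝ) = 0 := by
    by_contra h
    have h1 := (φ ⟨_, hxV⟩ : HalfSpace 3).2.2
    exact hx'.2 (chart_pos hM K V U hU φ _ (lt_of_le_of_ne h1 (Ne.symm h)))
  let z0 : {t : ℝ // 0 ≤ t} := ⟨0, le_rfl⟩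
  let W : Set E3 := {w | ((psi3.symm w).1, z0) ∈ U ∧ (psi3.symm w).2 ∈ Ioo (-1:ℝ) 1}
  have hW : IsOpen W := by
    apply IsOpen.inter
    · exact hU.preimage (f := fun w : E3 => (((psi3.symm w).1, z0) : HalfSpace 3)) (by fun_prop)
    · exact isOpen_Ioo.preimage (f := fun w : E3 => (psi3.symm w).2) (by fun_prop)
  have hWS : ∀ w : W, ((φ.symm ⟨_, w.2.1⟩ : K) : M) ∈ subsetBoundary 3 K := by
    intro w
    rw [bdry_eq hM]
    refine ⟨(φ.symm ⟨_, w.2.1⟩ : K).2, ?_⟩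
    apply chart_zero hM K V hV U φ
    rw [φ.apply_symm_apply]
  have := mfld_open hM W hW (fun w => b (⟨_, hWS w⟩, ⟨(psi3.symm w.1).2, Ioo_subset_Icc_self w.2.2⟩)) (by
      apply hb.continuous.comp
      apply Continuous.prodMk
      · apply Continuous.subtype_mk
        apply continuous_subtype_val.comp
        apply continuous_subtype_val.comp
        apply φ.symm.continuous.comp
        apply Continuous.subtype_mk
        fun_prop
      · apply Continuous.subtype_mk
        fun_prop) (by
      intro w w' h
      have h1 := hb.injective h
      simp only [Prod.mk.injEq, Subtype.mk.injEq] at h1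
      have h2 := φ.symm.injective (Subtype.val_injective (Subtype.val_injective h1.1))
      have h3 := congrArg Prod.fst (congrArg Subtype.val h2)
      exact Subtype.ext (psi3.symm.injective (Prod.ext h3 h1.2)))
  apply Filter.mem_of_superset (this.mem_nhds _)
  · rintro _ ⟨w, rfl⟩
    exact ⟨_, w.2.2, rfl⟩
  · set u0 := φ ⟨_, hxV⟩ with hu0
    have e : (((psi3.symm (psi3 ((u0 : HalfSpace 3).1, (t0:ℝ)))).1, z0) : HalfSpace 3) = u0 := by
      apply Prod.ext
      · simp
      · apply Subtype.ext; rw [h0]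
    refine ⟨⟨psi3 ((u0 : HalfSpace 3).1, (t0:ℝ)), ?_, ?_⟩, ?_⟩
    · rw [e]; exact u0.2
    · simpa using ht0
    · show b _ = b _
      congr 1
      apply Prod.ext
      · apply Subtype.ext
        simp only [e]
        simp [hu0]
      · apply Subtype.ext; simp

/-- open images -/
lemma bicollar_open' {M S : Type*} [TopologicalSpace M] [TopologicalSpace S]
    (b : S × ↥(Set.Icc (-1 : ℝ) 1) → M) (hb : Topology.IsEmbedding b)
    (ho : IsOpen (b '' {q | -1 < (q.2:ℝ) ∧ (q.2:ℝ) < 1}))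
    (G : Set (S × ↥(Set.Icc (-1 : ℝ) 1))) (hG : IsOpen G)
    (hG1 : ∀ q ∈ G, -1 < (q.2:ℝ) ∧ (q.2:ℝ) < 1) : IsOpen (b '' G) := by
  obtain ⟨O, hO, rfl⟩ := hb.isOpen_iff.1 hG
  have : b '' (b ⁻¹' O) = (b '' {q | -1 < (q.2:ℝ) ∧ (q.2:ℝ) < 1}) ∩ O := by
    ext m
    constructor
    · rintro ⟨q, hq, rfl⟩; exact ⟨⟨q, hG1 q hq, rfl⟩, hq⟩
    · rintro ⟨⟨q, -, rfl⟩, hq⟩; exact ⟨q, hq, rfl⟩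
  rw [this]
  exact ho.inter hO

lemma bicollar_sided {M : Type*} [TopologicalSpace M] [T2Space M] (K S : Set M)
    (hKc : IsCompact K) (hS : S = K \ interior K) (hcl : K ⊆ closure (interior K))
    (b : ↥S × ↥(Set.Icc (-1 : ℝ) 1) → M) (hb : Topology.IsEmbedding b)
    (hb0 : ∀ x : ↥S, b (x, ⟨0, by norm_num⟩) = (x : M))
    (ho : IsOpen (b '' {q | -1 < (q.2:ℝ) ∧ (q.2:ℝ) < 1})) :
    ∃ b' : ↥S × ↥(Set.Icc (-1 : ℝ) 1) → M, Topology.IsEmbedding b' ∧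
      (∀ x : ↥S, b' (x, ⟨0, by norm_num⟩) = (x : M)) ∧
      IsOpen (b' '' {q | -1 < (q.2:ℝ) ∧ (q.2:ℝ) < 1}) ∧
      ∀ q, b' q ∈ K ↔ (q.2:ℝ) ≤ 0 := by
  have hKcl : IsClosed K := hKc.isClosed
  have hnotS : ∀ q : ↥S × ↥(Set.Icc (-1 : ℝ) 1), (q.2:ℝ) ≠ 0 → b q ∉ S := by
    intro q hq h
    have h1 := hb.injective (hb0 ⟨b q, h⟩)
    exact hq (by rw [← h1])
  have hint : ∀ q : ↥S × ↥(Set.Icc (-1 : ℝ) 1), (q.2:ℝ) ≠ 0 → (b q ∈ K ↔ b q ∈ interior K) := by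
    intro q hq
    refine ⟨fun h => ?_, fun h => interior_subset h⟩
    by_contra h'
    exact hnotS q hq (by rw [hS]; exact ⟨h, h'⟩)
  -- the set where the value lies in K is clopen in nonzero levels
  have hconn : ∀ (x : S) (J : Set ↥(Set.Icc (-1 : ℝ) 1)), IsPreconnected J → (∀ t ∈ J, (t:ℝ) ≠ 0) →
      ∀ t ∈ J, ∀ t' ∈ J, b (x, t) ∈ K → b (x, t') ∈ K := by
    intro x J hJ hJ0 t ht t' ht' h
    by_contra h'
    have hcx : Continuous (fun t => b (x, t)) := hb.continuous.comp (by fun_prop)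
    obtain ⟨s, hs, hs1, hs2⟩ := hJ _ _ (isOpen_interior.preimage hcx) (hKcl.isOpen_compl.preimage hcx) (by
      intro s hs
      by_cases hsK : b (x, s) ∈ K
      · exact Or.inl ((hint _ (hJ0 s hs)).1 hsK)
      · exact Or.inr hsK) ⟨t, ht, (hint _ (hJ0 t ht)).1 h⟩ ⟨t', ht', h'⟩
    exact hs2 (interior_subset hs1)
  let I1 : ↥(Set.Icc (-1 : ℝ) 1) := ⟨1, by norm_num⟩
  let Im : ↥(Set.Icc (-1 : ℝ) 1) := ⟨-1, by norm_num⟩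
  have hpos : ∀ (x : S) (t : ↥(Set.Icc (-1 : ℝ) 1)), 0 < (t:ℝ) → (b (x, t) ∈ K ↔ b (x, I1) ∈ K) := by
    intro x t ht
    have hJ : IsPreconnected (Ioi (⟨0, by norm_num⟩ : ↥(Set.Icc (-1 : ℝ) 1))) := by
      rw [← IsInducing.subtypeVal.isPreconnected_image]
      convert (isPreconnected_Ioc : IsPreconnected (Ioc (0:ℝ) 1)) using 1
      ext s
      constructor
      · rintro ⟨r, hr, rfl⟩; exact ⟨hr, r.2.2⟩
      · intro hs; exact ⟨⟨s, by linarith [hs.1], hs.2⟩, hs.1, rfl⟩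
    have h0 : ∀ t ∈ (Ioi (⟨0, by norm_num⟩ : ↥(Set.Icc (-1 : ℝ) 1))), (t:ℝ) ≠ 0 := by
      intro t ht
      have : (0:ℝ) < t := ht
      exact this.ne'
    have h1 : I1 ∈ (Ioi (⟨0, by norm_num⟩ : ↥(Set.Icc (-1 : ℝ) 1))) := by
      show (0:ℝ) < 1
      norm_num
    exact ⟨hconn x _ hJ h0 t ht I1 h1, hconn x _ hJ h0 I1 h1 t ht⟩
  have hneg : ∀ (x : S) (t : ↥(Set.Icc (-1 : ℝ) 1)), (t:ℝ) < 0 → (b (x, t) ∈ K ↔ b (x, Im) ∈ K) := by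
    intro x t ht
    have hJ : IsPreconnected (Iio (⟨0, by norm_num⟩ : ↥(Set.Icc (-1 : ℝ) 1))) := by
      rw [← IsInducing.subtypeVal.isPreconnected_image]
      convert (isPreconnected_Ico : IsPreconnected (Ico (-1:ℝ) 0)) using 1
      ext s
      constructor
      · rintro ⟨r, hr, rfl⟩; exact ⟨r.2.1, hr⟩
      · intro hs; exact ⟨⟨s, hs.1, by linarith [hs.2]⟩, hs.2, rfl⟩
    have h0 : ∀ t ∈ (Iio (⟨0, by norm_num⟩ : ↥(Set.Icc (-1 : ℝ) 1))), (t:ℝ) ≠ 0 := by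
      intro t ht
      have : (t:ℝ) < 0 := ht
      exact this.ne
    have h1 : Im ∈ (Iio (⟨0, by norm_num⟩ : ↥(Set.Icc (-1 : ℝ) 1))) := by
      show (-1:ℝ) < 0
      norm_num
    exact ⟨hconn x _ hJ h0 t ht Im h1, hconn x _ hJ h0 Im h1 t ht⟩
  have hclop : ∀ t : ↥(Set.Icc (-1 : ℝ) 1), (t:ℝ) ≠ 0 → IsClopen {x : S | b (x, t) ∈ K} := by
    intro t ht
    have hct : Continuous (fun x => b (x, t)) := hb.continuous.comp (by fun_prop)
    refine ⟨hKcl.preimage hct, ?_⟩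
    have : {x : S | b (x, t) ∈ K} = (fun x => b (x, t)) ⁻¹' interior K := by
      ext x; exact hint (x, t) ht
    rw [this]
    exact isOpen_interior.preimage hct
  have hSK : ∀ x : S, (x:M) ∈ K := fun x => by
    exact (hS ▸ x.2 : (x:M) ∈ K \ interior K).1
  have hSi : ∀ x : S, (x:M) ∉ interior K := fun x => by
    exact (hS ▸ x.2 : (x:M) ∈ K \ interior K).2
  have htri : ∀ q : ↥S × ↥(Set.Icc (-1 : ℝ) 1), (q.2:ℝ) = 0 → b q = q.1 := by
    rintro ⟨x, t, ht⟩ h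
    simp only at h
    subst h
    exact hb0 x
  have hboth : ∀ x : S, ¬ (b (x, I1) ∈ K ∧ b (x, Im) ∈ K) := by
    rintro x ⟨h1, h2⟩
    apply hSi x
    let G : Set (↥S × ↥(Set.Icc (-1 : ℝ) 1)) := {q | b (q.1, I1) ∈ K} ∩ {q | b (q.1, Im) ∈ K} ∩ {q | -1 < (q.2:ℝ) ∧ (q.2:ℝ) < 1}
    have hG : IsOpen G := by
      apply IsOpen.inter
      · exact ((hclop I1 (by simp [I1])).2.preimage continuous_fst).inter ((hclop Im (by simp [Im])).2.preimage continuous_fst)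
      · exact isOpen_Ioo.preimage (f := fun q : ↥S × ↥(Set.Icc (-1 : ℝ) 1) => (q.2:ℝ)) (by fun_prop)
    refine mem_interior.2 ⟨b '' G, ?_, bicollar_open' b hb ho G hG (fun q hq => hq.2), ⟨(x, ⟨0, by norm_num⟩), ⟨⟨h1, h2⟩, by norm_num⟩, hb0 x⟩⟩
    rintro _ ⟨q, ⟨⟨hq1, hq2⟩, -⟩, rfl⟩
    rcases lt_trichotomy (q.2:ℝ) 0 with h | h | h
    · exact (hneg q.1 q.2 h).2 hq2
    · rw [htri q h]; exact hSK _
    · exact (hpos q.1 q.2 h).2 hq1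
  have hneither : ∀ x : S, b (x, I1) ∈ K ∨ b (x, Im) ∈ K := by
    intro x
    by_contra hcon
    push Not at hcon
    obtain ⟨h1, h2⟩ := hcon
    let G : Set (↥S × ↥(Set.Icc (-1 : ℝ) 1)) := {q | b (q.1, I1) ∉ K} ∩ {q | b (q.1, Im) ∉ K} ∩ {q | -1 < (q.2:ℝ) ∧ (q.2:ℝ) < 1}
    have hG : IsOpen G := by
      apply IsOpen.inter
      · exact ((hclop I1 (by simp [I1])).compl.2.preimage continuous_fst).inter ((hclop Im (by simp [Im])).compl.2.preimage continuous_fst)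
      · exact isOpen_Ioo.preimage (f := fun q : ↥S × ↥(Set.Icc (-1 : ℝ) 1) => (q.2:ℝ)) (by fun_prop)
    have hxG : (x:M) ∈ b '' G := ⟨(x, ⟨0, by norm_num⟩), ⟨⟨h1, h2⟩, by norm_num⟩, hb0 x⟩
    obtain ⟨y, hy1, hy2⟩ := mem_closure_iff.1 (hcl (hSK x)) _ (bicollar_open' b hb ho G hG (fun q hq => hq.2)) hxG
    obtain ⟨q, ⟨⟨hq1, hq2⟩, -⟩, rfl⟩ := hy1
    rcases lt_trichotomy (q.2:ℝ) 0 with h | h | h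
    · exact hq2 ((hneg q.1 q.2 h).1 (interior_subset hy2))
    · rw [htri q h] at hy2; exact hSi _ hy2
    · exact hq1 ((hpos q.1 q.2 h).1 (interior_subset hy2))
  classical
  let sg : S → ℝ := fun x => if b (x, I1) ∈ K then -1 else 1
  have hsg : Continuous sg := by
    apply continuous_if
    · intro x hx
      have := (hclop I1 (by simp [I1])).frontier_eq
      change x ∈ frontier {x : S | b (x, I1) ∈ K} at hx
      rw [this] at hx; exact hx.elim
    · exact continuousOn_const
    · exact continuousOn_const
  have hsg2 : ∀ x, sg x = 1 ∨ sg x = -1 := by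
    intro x; simp only [sg]; split_ifs <;> simp
  have hmemI : ∀ (x : S) (t : ↥(Set.Icc (-1 : ℝ) 1)), sg x * t ∈ Icc (-1:ℝ) 1 := by
    intro x t
    have := t.2
    rcases hsg2 x with h | h <;> rw [h] <;> constructor <;> linarith [this.1, this.2]
  let e : ↥S × ↥(Set.Icc (-1 : ℝ) 1) → ↥S × ↥(Set.Icc (-1 : ℝ) 1) := fun q => (q.1, ⟨sg q.1 * q.2, hmemI _ _⟩)
  have hee : ∀ q, e (e q) = q := by
    intro q
    apply Prod.ext
    · rfl
    · apply Subtype.ext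
      simp only [e]
      rcases hsg2 q.1 with h | h <;> rw [h] <;> ring
  have hec : Continuous e := by
    apply Continuous.prodMk continuous_fst
    apply Continuous.subtype_mk
    fun_prop
  let eh : ↥S × ↥(Set.Icc (-1 : ℝ) 1) ≃ₜ ↥S × ↥(Set.Icc (-1 : ℝ) 1) :=
    { toFun := e, invFun := e, left_inv := hee, right_inv := hee, continuous_toFun := hec, continuous_invFun := hec }
  refine ⟨b ∘ e, hb.comp eh.isEmbedding, ?_, ?_, ?_⟩
  · intro x
    simp only [Function.comp]
    rw [htri _ (by simp [e])]
  · have : (b ∘ e) '' {q | -1 < (q.2:ℝ) ∧ (q.2:ℝ) < 1} = b '' {q | -1 < (q.2:ℝ) ∧ (q.2:ℝ) < 1} := by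
      have hst : ∀ q : ↥S × ↥(Set.Icc (-1 : ℝ) 1), (-1 < (q.2:ℝ) ∧ (q.2:ℝ) < 1) → (-1 < ((e q).2:ℝ) ∧ ((e q).2:ℝ) < 1) := by
        intro q hq
        simp only [e]
        rcases hsg2 q.1 with h | h <;> rw [h] <;> constructor <;> linarith [hq.1, hq.2]
      ext m
      constructor
      · rintro ⟨q, hq, rfl⟩; exact ⟨e q, hst q hq, rfl⟩
      · rintro ⟨q, hq, rfl⟩; exact ⟨e q, hst q hq, by simp [hee]⟩
    rw [this]; exact ho
  · intro q
    simp only [Function.comp]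
    rcases lt_trichotomy (q.2:ℝ) 0 with h | h | h
    · refine ⟨fun _ => h.le, fun _ => ?_⟩
      by_cases hq : b (q.1, I1) ∈ K
      · refine (hpos (e q).1 (e q).2 ?_).2 hq
        simp only [e, sg, if_pos hq]; linarith
      · refine (hneg (e q).1 (e q).2 ?_).2 ((hneither q.1).resolve_left hq)
        simp only [e, sg, if_neg hq]; linarith
    · refine ⟨fun _ => h.le, fun _ => ?_⟩
      rw [htri (e q) (by simp [e, h])]
      exact hSK _
    · refine ⟨fun h' => absurd h' ?_, fun h' => absurd h' (by linarith)⟩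
      by_cases hq : b (q.1, I1) ∈ K
      · have h3 : b (q.1, Im) ∉ K := fun h4 => hboth _ ⟨hq, h4⟩
        refine fun h4 => h3 ((hneg (e q).1 (e q).2 ?_).1 h4)
        simp only [e, sg, if_pos hq]; linarith
      · refine fun h4 => hq ((hpos (e q).1 (e q).2 ?_).1 h4)
        simp only [e, sg, if_neg hq]; linarith

lemma collar_of_sided {M : Type*} [TopologicalSpace M] [T2Space M] (K S : Set M)
    (hKc : IsCompact K) (hS : S = K \ interior K) (hne : S.Nonempty)
    (b : ↥S × ↥(Set.Icc (-1 : ℝ) 1) → M) (hb : Topology.IsEmbedding b)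
    (hb0 : ∀ x : ↥S, b (x, ⟨0, by norm_num⟩) = (x : M))
    (ho : IsOpen (b '' {q | -1 < (q.2:ℝ) ∧ (q.2:ℝ) < 1}))
    (hbK : ∀ q, b q ∈ K ↔ (q.2:ℝ) ≤ 0) :
    ∃ C : CollarData M S, (∀ m, 0 ≤ C.τ m) ∧ K = {m | C.τ m ≤ 0} ∧
      ∀ t < 1, IsCompact {m | C.τ m ≤ t} := by
  classical
  have hScomp : IsCompact S := by
    rw [hS]; exact hKc.diff isOpen_interior
  have : CompactSpace S := isCompact_iff_compactSpace.1 hScomp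
  have : Nonempty S := hne.to_subtype
  let P : M → Prop := fun m => ∃ q : ↥S × ↥(Set.Icc (-1 : ℝ) 1), b q = m
  let inv : M → ↥S × ↥(Set.Icc (-1 : ℝ) 1) := fun m => if h : P m then h.choose else (Classical.arbitrary _, ⟨1, by norm_num⟩)
  have hinv : ∀ q, inv (b q) = q := by
    intro q
    have h : P (b q) := ⟨q, rfl⟩
    simp only [inv, dif_pos h]
    exact hb.injective h.choose_spec
  have hinv2 : ∀ m, ¬ P m → ((inv m).2:ℝ) = 1 := by
    intro m h
    simp only [inv, dif_neg h]
  let τ : M → ℝ := fun m => if m ∈ K then 0 else (inv m).2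
  have hτK : ∀ m ∈ K, τ m = 0 := fun m hm => by simp only [τ, if_pos hm]
  have hτn : ∀ m ∉ K, τ m = (inv m).2 := fun m hm => by simp only [τ, if_neg hm]
  have hτb : ∀ q, τ (b q) = max 0 (q.2:ℝ) := by
    intro q
    by_cases h : b q ∈ K
    · rw [hτK _ h, max_eq_left ((hbK q).1 h)]
    · rw [hτn _ h, hinv, max_eq_right]
      exact (not_le.1 (fun h' => h ((hbK q).2 h'))).le
  have hcases : ∀ m, m ∈ K ∨ (m ∉ K ∧ ¬ P m ∧ τ m = 1) ∨ ∃ q, b q = m ∧ 0 < (q.2:ℝ) ∧ τ m = q.2 := by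
    intro m
    by_cases h : m ∈ K
    · exact Or.inl h
    · right
      by_cases h2 : P m
      · right
        obtain ⟨q, rfl⟩ := h2
        refine ⟨q, rfl, not_le.1 (fun h' => h ((hbK q).2 h')), ?_⟩
        rw [hτn _ h, hinv]
      · left; exact ⟨h, h2, by rw [hτn _ h, hinv2 _ h2]⟩
  have hle : ∀ t, 0 ≤ t → t < 1 → {m | τ m ≤ t} = K ∪ b '' {q | (q.2:ℝ) ≤ t} := by
    intro t ht0 ht1
    ext m
    constructor
    · intro hm
      change τ m ≤ t at hm
      rcases hcases m with h | ⟨-, -, h⟩ | ⟨q, rfl, h1, h2⟩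
      · exact Or.inl h
      · linarith
      · exact Or.inr ⟨q, by change (q.2:ℝ) ≤ t; linarith, rfl⟩
    · rintro (h | ⟨q, hq, rfl⟩)
      · change τ m ≤ t; rw [hτK m h]; exact ht0
      · change τ (b q) ≤ t; rw [hτb]; exact max_le ht0 hq
  have hlecomp : ∀ t, 0 ≤ t → t < 1 → IsCompact {m | τ m ≤ t} := by
    intro t ht0 ht1
    rw [hle t ht0 ht1]
    apply hKc.union
    apply IsCompact.image _ hb.continuous
    apply IsClosed.isCompact
    exact isClosed_le (f := fun q : ↥S × ↥(Set.Icc (-1 : ℝ) 1) => (q.2:ℝ)) (g := fun _ => t) (by fun_prop) continuous_const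
  have hnn : ∀ m, 0 ≤ τ m := by
    intro m
    rcases hcases m with h | ⟨-, -, h⟩ | ⟨q, rfl, h1, h2⟩
    · rw [hτK m h]
    · rw [h]; norm_num
    · rw [h2]; exact h1.le
  have hle1 : ∀ m, τ m ≤ 1 := by
    intro m
    rcases hcases m with h | ⟨-, -, h⟩ | ⟨q, rfl, h1, h2⟩
    · rw [hτK m h]; norm_num
    · rw [h]
    · rw [h2]; exact q.2.2.2
  have hlt : ∀ t, 0 < t → t ≤ 1 → {m | τ m < t} = interior K ∪ b '' {q | -1 < (q.2:ℝ) ∧ (q.2:ℝ) < t} := by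
    intro t ht0 ht1
    ext m
    constructor
    · intro hm
      change τ m < t at hm
      rcases hcases m with h | ⟨-, -, h⟩ | ⟨q, rfl, h1, h2⟩
      · by_cases hi : m ∈ interior K
        · exact Or.inl hi
        · right
          exact ⟨(⟨m, by rw [hS]; exact ⟨h, hi⟩⟩, ⟨0, by norm_num⟩), ⟨by norm_num, ht0⟩, hb0 _⟩
      · linarith
      · exact Or.inr ⟨q, ⟨by linarith, by linarith⟩, rfl⟩
    · rintro (h | ⟨q, hq, rfl⟩)
      · change τ m < t; rw [hτK m (interior_subset h)]; exact ht0
      · change τ (b q) < t; rw [hτb]; exact max_lt ht0 hq.2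
  have hτc : Continuous τ := by
    rw [OrderTopology.continuous_iff]
    intro t
    constructor
    · rcases lt_or_ge t 0 with h0 | h0
      · convert isOpen_univ using 1
        ext m; simp only [mem_preimage, mem_Ioi, mem_univ, iff_true]; linarith [hnn m]
      rcases lt_or_ge t 1 with h1 | h1
      · convert (hlecomp t h0 h1).isClosed.isOpen_compl using 1
        ext m; simp
      · convert isOpen_empty using 1
        ext m; simp only [mem_preimage, mem_Ioi, mem_empty_iff_false, iff_false]; linarith [hle1 m]
    · rcases le_or_gt t 0 with h0 | h0
      · convert isOpen_empty using 1
        ext m; simp only [mem_preimage, mem_Iio, mem_empty_iff_false, iff_false]; linarith [hnn m]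
      rcases le_or_gt t 1 with h1 | h1
      · change IsOpen {m | τ m < t}
        rw [hlt t h0 h1]
        apply isOpen_interior.union
        apply bicollar_open' b hb ho
        · exact isOpen_Ioo.preimage (f := fun q : ↥S × ↥(Set.Icc (-1 : ℝ) 1) => (q.2:ℝ)) (by fun_prop)
        · intro q hq; exact ⟨hq.1, by linarith [hq.2]⟩
      · convert isOpen_univ using 1
        ext m; simp only [mem_preimage, mem_Iio, mem_univ, iff_true]; linarith [hle1 m]
  have hpr : ∀ t, t ∈ Ioo (0:ℝ) 1 → ((projIcc (-1:ℝ) 1 (by norm_num) t : ↥(Set.Icc (-1 : ℝ) 1)) : ℝ) = t := by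
    intro t ht
    rw [projIcc_of_mem _ ⟨by linarith [ht.1], ht.2.le⟩]
  refine ⟨⟨τ, fun q => b (q.1, projIcc (-1:ℝ) 1 (by norm_num) q.2), fun m => (inv m).1, hτc, ?_, ?_, ?_, ?_, ?_⟩, hnn, ?_, ?_⟩
  · apply Continuous.continuousOn
    apply hb.continuous.comp
    apply Continuous.prodMk continuous_fst
    exact continuous_projIcc.comp continuous_snd
  · intro m hm
    apply ContinuousAt.continuousWithinAt
    rcases hcases m with h | ⟨-, -, h⟩ | ⟨q, rfl, h1, h2⟩
    · have := hm.1; rw [hτK m h] at this; exact absurd this (lt_irrefl _)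
    · have := hm.2; rw [h] at this; exact absurd this (lt_irrefl _)
    · rw [ContinuousAt]
      simp only [hinv]
      have hm2 := hm.2
      rw [h2] at hm2
      intro N hN
      obtain ⟨O, hON, hO, hqO⟩ := mem_nhds_iff.1 hN
      have ho2 : IsOpen (b '' ({q | q.1 ∈ O} ∩ {q | -1 < (q.2:ℝ) ∧ (q.2:ℝ) < 1})) := by
        apply bicollar_open' b hb ho
        · apply (hO.preimage continuous_fst).inter
          exact isOpen_Ioo.preimage (f := fun q : ↥S × ↥(Set.Icc (-1 : ℝ) 1) => (q.2:ℝ)) (by fun_prop)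
        · exact fun q hq => hq.2
      rw [Filter.mem_map]
      refine Filter.mem_of_superset (ho2.mem_nhds ⟨q, ⟨hqO, by linarith, hm2⟩, rfl⟩) ?_
      rintro _ ⟨q', ⟨hq', -⟩, rfl⟩
      apply hON
      simp only [hinv]
      exact hq'
  · intro x t ht
    simp only [hτb, hpr t ht]
    exact max_eq_right ht.1.le
  · intro x t ht
    simp only [hinv]
  · intro m hm
    rcases hcases m with h | ⟨-, -, h⟩ | ⟨q, rfl, h1, h2⟩
    · have := hm.1; rw [hτK m h] at this; exact absurd this (lt_irrefl _)
    · have := hm.2; rw [h] at this; exact absurd this (lt_irrefl _)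
    · simp only [hinv]
      congr 1
      apply Prod.ext
      · rfl
      · apply Subtype.ext
        simp only
        rw [hpr _ hm, h2]
  · ext m
    constructor
    · intro h; exact (hτK m h).le
    · intro h
      change τ m ≤ 0 at h
      rcases hcases m with h' | ⟨-, -, h'⟩ | ⟨q, rfl, h1, h2⟩
      · exact h'
      · linarith
      · linarith
  · intro t ht
    rcases lt_or_ge t 0 with h0 | h0
    · convert isCompact_empty using 1
      ext m
      simp only [mem_ofPred_eq, mem_empty_iff_false, iff_false]
      have := hnn m
      intro h
      linarith
    · exact hlecomp t h0 ht

lemma collar_exists {M : Type*} [TopologicalSpace M] [T2Space M] (hM : LocallyEuclidean 3 M)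
    (K : Set M) (hK : IsCompactMfldBdry 3 K) (hbicol : Bicollared (subsetBoundary 3 K))
    (hne : (subsetBoundary 3 K).Nonempty) :
    ∃ C : CollarData M ↥(subsetBoundary 3 K), (∀ m, 0 ≤ C.τ m) ∧ K = {m | C.τ m ≤ 0} ∧
      ∀ t < 1, IsCompact {m | C.τ m ≤ t} := by
  obtain ⟨b, hb, hb0⟩ := hbicol
  obtain ⟨b', hb', hb0', ho', hK'⟩ := bicollar_sided K _ hK.1 (bdry_eq hM K) (S_closure hM K hK.2) b hb hb0
    (bicollar_open hM K hK.2 b hb)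
  exact collar_of_sided K _ hK.1 (bdry_eq hM K) hne b' hb' hb0' ho' hK'

end Bicollar

section Radial

/-- piecewise linear reparametrization -/
noncomputable def plf (lo p q hi t : ℝ) : ℝ :=
  if t ≤ lo then t else if t ≤ p then lo + (t - lo) * ((q - lo) / (p - lo))
  else if t ≤ hi then hi - (hi - t) * ((hi - q) / (hi - p)) else t

lemma plf_inv {lo p q hi : ℝ} (h1 : lo < p) (h2 : p < hi) (h3 : lo < q) (h4 : q < hi) (t : ℝ) :
    plf lo q p hi (plf lo p q hi t) = t := by
  have u1 : 0 < (q - lo) / (p - lo) := div_pos (by linarith) (by linarith)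
  have v1 : 0 < (hi - q) / (hi - p) := div_pos (by linarith) (by linarith)
  have u2 : (q - lo) / (p - lo) * (p - lo) = q - lo := div_mul_cancel₀ _ (by linarith)
  have v2 : (hi - q) / (hi - p) * (hi - p) = hi - q := div_mul_cancel₀ _ (by linarith)
  have u3 : (q - lo) / (p - lo) * ((p - lo) / (q - lo)) = 1 := by
    have : p - lo ≠ 0 := by linarith
    have : q - lo ≠ 0 := by linarith
    field_simp
  have v3 : (hi - q) / (hi - p) * ((hi - p) / (hi - q)) = 1 := by
    have : hi - p ≠ 0 := by linarith
    have : hi - q ≠ 0 := by linarith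
    field_simp
  set u := (q - lo) / (p - lo)
  set v := (hi - q) / (hi - p)
  set u' := (p - lo) / (q - lo)
  set v' := (hi - p) / (hi - q)
  unfold plf
  by_cases c1 : t ≤ lo
  · rw [if_pos c1, if_pos c1]
  · push Not at c1
    rw [if_neg (not_le.2 c1)]
    by_cases c2 : t ≤ p
    · rw [if_pos c2]
      have e1 : ¬ (lo + (t - lo) * u ≤ lo) := by nlinarith
      have e2 : lo + (t - lo) * u ≤ q := by nlinarith
      rw [if_neg e1, if_pos e2]
      have : (lo + (t - lo) * u - lo) * u' = (t - lo) * (u * u') := by ring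
      rw [this, u3]; ring
    · push Not at c2
      rw [if_neg (not_le.2 c2)]
      by_cases c3 : t ≤ hi
      · rw [if_pos c3]
        have e2 : ¬ (hi - (hi - t) * v ≤ q) := by nlinarith
        have e1 : ¬ (hi - (hi - t) * v ≤ lo) := by linarith
        have e3 : hi - (hi - t) * v ≤ hi := by nlinarith
        rw [if_neg e1, if_neg e2, if_pos e3]
        have : (hi - (hi - (hi - t) * v)) * v' = (hi - t) * (v * v') := by ring
        rw [this, v3]; ring
      · push Not at c3
        rw [if_neg (not_le.2 c3), if_neg (by linarith), if_neg (by linarith), if_neg (by linarith)]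

lemma plf_mono {lo p q hi : ℝ} (h1 : lo < p) (h2 : p < hi) (h3 : lo < q) (h4 : q < hi) :
    StrictMono (plf lo p q hi) := by
  have hinj : Function.Injective (plf lo p q hi) :=
    Function.LeftInverse.injective (plf_inv h1 h2 h3 h4)
  refine Monotone.strictMono_of_injective ?_ hinj
  have u1 : 0 < (q - lo) / (p - lo) := div_pos (by linarith) (by linarith)
  have v1 : 0 < (hi - q) / (hi - p) := div_pos (by linarith) (by linarith)
  have u2 : (q - lo) / (p - lo) * (p - lo) = q - lo := div_mul_cancel₀ _ (by linarith)
  have v2 : (hi - q) / (hi - p) * (hi - p) = hi - q := div_mul_cancel₀ _ (by linarith)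
  intro s t hst
  unfold plf
  set u := (q - lo) / (p - lo)
  set v := (hi - q) / (hi - p)
  split_ifs <;> nlinarith

/-- the reparametrization as an order isomorphism -/
noncomputable def plIso {lo p q hi : ℝ} (h1 : lo < p) (h2 : p < hi) (h3 : lo < q) (h4 : q < hi) : ℝ ≃o ℝ :=
  (plf_mono h1 h2 h3 h4).orderIsoOfRightInverse _ (plf lo q p hi) (plf_inv h3 h4 h1 h2)

lemma exists_rho {lo p q hi : ℝ} (h1 : lo < p) (h2 : p < hi) (h3 : lo < q) (h4 : q < hi) :
    ∃ ρ : ℝ ≃o ℝ, ρ p = q ∧ (∀ t ≤ lo, ρ t = t) ∧ ∀ t, hi ≤ t → ρ t = t := by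
  refine ⟨plIso h1 h2 h3 h4, ?_, ?_, ?_⟩
  · show plf lo p q hi p = q
    unfold plf
    rw [if_neg (by linarith), if_pos le_rfl, mul_div_cancel₀ _ (by linarith)]
    ring
  · intro t ht
    show plf lo p q hi t = t
    unfold plf
    rw [if_pos ht]
  · intro t ht
    show plf lo p q hi t = t
    unfold plf
    rw [if_neg (by linarith), if_neg (by linarith)]
    split_ifs with h
    · have : hi = t := le_antisymm ht h
      rw [this]; ring
    · rfl

variable {M S : Type*} [TopologicalSpace M] [TopologicalSpace S]

/-- reversed collar -/
def CollarData.rev (C : CollarData M S) : CollarData M S where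
  τ := fun m => 1 - C.τ m
  c := fun q => C.c (q.1, 1 - q.2)
  p := C.p
  hτ := continuous_const.sub C.hτ
  hc := by
    apply C.hc.comp (by fun_prop)
    rintro ⟨x, t⟩ ⟨-, ht⟩
    exact ⟨mem_univ _, by simp only; linarith [ht.2], by simp only; linarith [ht.1]⟩
  hp := C.hp.mono (fun m hm => ⟨by linarith [hm.2], by linarith [hm.1]⟩)
  τc := fun x t ht => by
    rw [C.τc x (1 - t) ⟨by linarith [ht.2], by linarith [ht.1]⟩]; ring
  pc := fun x t ht => C.pc x (1 - t) ⟨by linarith [ht.2], by linarith [ht.1]⟩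
  cp := fun m hm => by
    simp only [sub_sub_cancel]
    exact C.cp m ⟨by linarith [hm.2], by linarith [hm.1]⟩

lemma CollarData.band_compact [CompactSpace S] (C : CollarData M S) {a b : ℝ} (ha : 0 < a) (hb : b < 1) :
    IsCompact {m | a ≤ C.τ m ∧ C.τ m ≤ b} := by
  have h1 : IsCompact (C.c '' (univ ×ˢ Icc a b)) := by
    apply IsCompact.image_of_continuousOn (isCompact_univ.prod isCompact_Icc)
    apply C.hc.mono
    rintro ⟨x, t⟩ ⟨-, ht⟩
    exact ⟨mem_univ _, by linarith [ht.1], by linarith [ht.2]⟩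
  convert h1 using 1
  ext m
  constructor
  · intro hm
    exact ⟨(C.p m, C.τ m), ⟨mem_univ _, hm⟩, C.cp m ⟨by linarith [hm.1], by linarith [hm.2]⟩⟩
  · rintro ⟨⟨x, t⟩, ⟨-, ht⟩, rfl⟩
    simp only [mem_ofPred_eq]
    rw [C.τc x t ⟨by linarith [ht.1], by linarith [ht.2]⟩]
    exact ht

lemma CollarData.gap [CompactSpace S] (C : CollarData M S) {a e : ℝ} (ha : 0 < a) (hae : a < e) (he : e < 1)
    (F : Set M) (hF : IsClosed F) (hFa : ∀ m ∈ F, a < C.τ m) :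
    ∃ η, a < η ∧ η < e ∧ ∀ m ∈ F, η ≤ C.τ m := by
  have h1 : IsCompact ({m | a ≤ C.τ m ∧ C.τ m ≤ e} ∩ F) := (C.band_compact ha he).inter_right hF
  obtain ⟨d, hd, hdle⟩ := h1.exists_forall_le' (f := C.τ) C.hτ.continuousOn (a := a) (fun m hm => hFa m hm.2)
  refine ⟨min d ((a + e)/2), lt_min hd (by linarith), (min_le_right _ _).trans_lt (by linarith), ?_⟩
  intro m hm
  by_cases h : C.τ m ≤ e
  · exact (min_le_left _ _).trans (hdle m ⟨⟨(hFa m hm).le, h⟩, hm⟩)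
  · exact (min_le_right _ _).trans (by linarith)

open Classical in
/-- radial map -/
noncomputable def CollarData.rad (C : CollarData M S) (ρ : ℝ → ℝ) (m : M) : M :=
  if C.τ m ∈ Ioo (0:ℝ) 1 then C.c (C.p m, ρ (C.τ m)) else m

lemma CollarData.radial (C : CollarData M S) {lo p q hi : ℝ} (h0 : 0 < lo) (h1 : lo < p) (h2 : p < hi)
    (h3 : lo < q) (h4 : q < hi) (h5 : hi < 1) :
    ∃ h : M ≃ₜ M, (∀ m, C.τ m ≤ lo → h m = m) ∧ (∀ m, hi ≤ C.τ m → h m = m) ∧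
      (∀ m, p ≤ C.τ m ↔ q ≤ C.τ (h m)) := by
  obtain ⟨ρ, hpq, hlo, hhi⟩ := exists_rho h1 h2 h3 h4
  have key : ∀ ρ : ℝ ≃o ℝ, (∀ t ≤ lo, ρ t = t) → (∀ t, hi ≤ t → ρ t = t) →
      Continuous (C.rad ρ) ∧ (∀ m, C.τ (C.rad ρ m) = ρ (C.τ m)) ∧
      (∀ m, C.τ m ≤ lo → C.rad ρ m = m) ∧ (∀ m, hi ≤ C.τ m → C.rad ρ m = m) ∧
      (∀ m, C.τ m ∈ Ioo (0:ℝ) 1 → C.p (C.rad ρ m) = C.p m) ∧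
      (∀ t, t ∈ Ioo (0:ℝ) 1 → ρ t ∈ Ioo (0:ℝ) 1) := by
    intro ρ hlo hhi
    have hI : ∀ t, t ∈ Ioo (0:ℝ) 1 → ρ t ∈ Ioo (0:ℝ) 1 := by
      intro t ht
      constructor
      · rw [← hlo 0 h0.le]; exact ρ.strictMono ht.1
      · rw [← hhi 1 h5.le]; exact ρ.strictMono ht.2
    have e1 : ∀ m, C.τ m ≤ lo → C.rad ρ m = m := by
      intro m hm
      unfold CollarData.rad
      split_ifs with h
      · rw [hlo _ hm]; exact C.cp m h
      · rfl
    have e2 : ∀ m, hi ≤ C.τ m → C.rad ρ m = m := by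
      intro m hm
      unfold CollarData.rad
      split_ifs with h
      · rw [hhi _ hm]; exact C.cp m h
      · rfl
    refine ⟨?_, ?_, e1, e2, ?_, hI⟩
    · rw [continuous_iff_continuousAt]
      intro m
      by_cases hm : C.τ m ∈ Ioo (0:ℝ) 1
      · have hO : IsOpen (C.τ ⁻¹' Ioo (0:ℝ) 1) := isOpen_Ioo.preimage C.hτ
        have hc : ContinuousOn (fun m => C.c (C.p m, ρ (C.τ m))) (C.τ ⁻¹' Ioo (0:ℝ) 1) := by
          apply C.hc.comp (C.hp.prodMk (ρ.continuous.comp C.hτ).continuousOn)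
          intro m hm
          exact ⟨mem_univ _, hI _ hm⟩
        apply (hc.continuousAt (hO.mem_nhds hm)).congr
        filter_upwards [hO.mem_nhds hm] with y hy
        unfold CollarData.rad
        rw [if_pos (show C.τ y ∈ Ioo (0:ℝ) 1 from hy)]
      · have hO : IsOpen (C.τ ⁻¹' (Iio lo ∪ Ioi hi)) := (isOpen_Iio.union isOpen_Ioi).preimage C.hτ
        have hm' : m ∈ C.τ ⁻¹' (Iio lo ∪ Ioi hi) := by
          rw [mem_Ioo, not_and_or, not_lt, not_lt] at hm
          rcases hm with hm | hm
          · left; show C.τ m < lo; linarith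
          · right; show hi < C.τ m; linarith
        apply continuousAt_id.congr
        filter_upwards [hO.mem_nhds hm'] with y hy
        rcases hy with hy | hy
        · exact (e1 y (le_of_lt hy)).symm
        · exact (e2 y (le_of_lt hy)).symm
    · intro m
      by_cases hm : C.τ m ∈ Ioo (0:ℝ) 1
      · unfold CollarData.rad
        rw [if_pos hm, C.τc _ _ (hI _ hm)]
      · rw [mem_Ioo, not_and_or, not_lt, not_lt] at hm
        rcases hm with hm | hm
        · rw [e1 m (by linarith), hlo _ (by linarith)]
        · rw [e2 m (by linarith), hhi _ (by linarith)]
    · intro m hm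
      unfold CollarData.rad
      rw [if_pos hm, C.pc _ _ (hI _ hm)]
  have comp : ∀ ρ ρ' : ℝ ≃o ℝ, (∀ t, ρ' (ρ t) = t) → (∀ t ≤ lo, ρ t = t) → (∀ t, hi ≤ t → ρ t = t) →
      ∀ m, C.rad ρ' (C.rad ρ m) = m := by
    intro ρ ρ' hr hlo hhi m
    obtain ⟨-, k2, k3, k4, k5, hI⟩ := key ρ hlo hhi
    by_cases hm : C.τ m ∈ Ioo (0:ℝ) 1
    · have : C.rad ρ' (C.rad ρ m) = C.c (C.p (C.rad ρ m), ρ' (C.τ (C.rad ρ m))) := by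
        conv_lhs => unfold CollarData.rad
        rw [if_pos]
        · rfl
        · have := k2 m
          unfold CollarData.rad at this
          rw [this]; exact hI _ hm
      rw [this, k5 m hm, k2 m, hr]
      exact C.cp m hm
    · have : C.rad ρ m = m := by
        unfold CollarData.rad; rw [if_neg hm]
      rw [this]
      unfold CollarData.rad; rw [if_neg hm]
  have hlo' : ∀ t ≤ lo, ρ.symm t = t := fun t ht => by rw [ρ.symm_apply_eq, hlo t ht]
  have hhi' : ∀ t, hi ≤ t → ρ.symm t = t := fun t ht => by rw [ρ.symm_apply_eq, hhi t ht]
  obtain ⟨k1, k2, k3, k4, -, -⟩ := key ρ hlo hhi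
  obtain ⟨k1', -⟩ := key ρ.symm hlo' hhi'
  refine ⟨⟨⟨C.rad ρ, C.rad ρ.symm, ?_, ?_⟩, k1, k1'⟩, k3, k4, ?_⟩
  · exact comp ρ ρ.symm (fun t => ρ.symm_apply_apply t) hlo hhi
  · exact comp ρ.symm ρ (fun t => ρ.apply_symm_apply t) hlo' hhi'
  · intro m
    show p ≤ C.τ m ↔ q ≤ C.τ (C.rad ρ m)
    rw [k2, ← hpq, ρ.le_iff_le]

end Radial

section LemmaD
variable {M S : Type*} [TopologicalSpace M] [T2Space M] [TopologicalSpace S] [CompactSpace S]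

lemma homeo_fix {M : Type*} [TopologicalSpace M] (T : M ≃ₜ M) {m : M} (h : T m = m) : T.symm m = m := by
  rw [Homeomorph.symm_apply_eq]; exact h.symm

lemma lemD_step (C : CollarData M S) {a β b : ℝ} (ha : 0 < a) (hβb : β < b) (haβ : a < β) (hb : b < 1)
    (A : Set M) (hA : ∀ m ∈ A, b ≤ C.τ m) (O : ℕ → Set M) (hOc : ∀ n, IsClosed (O n))
    (hOanti : Antitone O) (hOA : ⋂ n, O n = A) (hO0 : ∀ m ∈ O 0, a ≤ C.τ m)
    (hT : ∀ n, ∃ T : M ≃ₜ M, (∀ m, C.τ m ≤ a → T m = m) ∧ (∀ m ∈ A, T m = m) ∧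
      ∀ m, β ≤ C.τ m → T m ∈ O n)
    (Φ : M ≃ₜ M) (hΦa : ∀ m, C.τ m ≤ a → Φ m = m) (hΦA : ∀ m ∈ A, Φ m = m)
    {c c' : ℝ} (hac : a < c) (hcc' : c < c') (hc'b : c' < b) (n : ℕ) :
    ∃ Φ' : M ≃ₜ M, (∀ m, C.τ m ≤ a → Φ' m = m) ∧ (∀ m ∈ A, Φ' m = m) ∧
      (∀ m, C.τ m < c → Φ' m = Φ m) ∧ (∀ m, c' ≤ C.τ m → Φ' m ∈ O n) := by
  have hQ : IsCompact (Φ '' {m | a ≤ C.τ m ∧ C.τ m ≤ c'}) :=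
    (C.band_compact ha (by linarith)).image Φ.continuous
  have hQA : Φ '' {m | a ≤ C.τ m ∧ C.τ m ≤ c'} ∩ ⋂ n, O n = ∅ := by
    rw [hOA, eq_empty_iff_forall_notMem]
    rintro _ ⟨⟨m, hm, rfl⟩, hmA⟩
    have h1 := Φ.injective (hΦA _ hmA)
    rw [h1] at hmA
    have := hA _ hmA
    linarith [hm.2]
  obtain ⟨i, hi⟩ := hQ.elim_directed_family_closed O hOc hQA
    (fun i j => ⟨max i j, hOanti (le_max_left _ _), hOanti (le_max_right _ _)⟩)
  let N := max n i
  obtain ⟨T, hTa, hTA, hTO⟩ := hT N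
  have hB : ∀ m, β ≤ C.τ m → c' < C.τ (Φ.symm (T m)) := by
    intro m hm
    by_contra h
    push Not at h
    have h1 := hTO m hm
    have h2 : T m ∉ Φ '' {m | a ≤ C.τ m ∧ C.τ m ≤ c'} := by
      intro h3
      have : T m ∈ Φ '' {m | a ≤ C.τ m ∧ C.τ m ≤ c'} ∩ O i := ⟨h3, hOanti (le_max_right _ _) h1⟩
      rw [hi] at this; exact this
    apply h2
    refine ⟨Φ.symm (T m), ⟨?_, h⟩, by simp⟩
    by_contra h4
    push Not at h4
    have h5 := hΦa _ h4.le
    rw [Φ.apply_symm_apply] at h5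
    rw [← h5] at h4
    exact absurd (hO0 _ (hOanti (Nat.zero_le _) h1)) (not_le.2 h4)
  -- eta
  have hsub : ∀ (P Q : M ≃ₜ M), (∀ m, C.τ m ≤ a → P m = m) → (∀ m, C.τ m ≤ a → Q m = m) →
      ∀ m, a < C.τ m → a < C.τ (P.symm (Q m)) := by
    intro P Q hP hQ m hm
    by_contra h
    push Not at h
    have h1 := hP _ h
    rw [P.apply_symm_apply] at h1
    rw [← h1] at h
    have h3 := Q.injective (hQ _ h)
    rw [h3] at h
    linarith
  obtain ⟨η, haη, hηβ, hη⟩ := C.gap ha haβ (by linarith) {y | c' ≤ C.τ (Φ.symm (T y))}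
    (isClosed_le continuous_const (C.hτ.comp (Φ.symm.continuous.comp T.continuous))) (by
      intro y hy
      change c' ≤ C.τ (Φ.symm (T y)) at hy
      by_contra h
      push Not at h
      rw [hTa y h, homeo_fix Φ (hΦa y h)] at hy
      linarith)
  have hlo : a < (a + η)/2 := by linarith
  obtain ⟨s, s1, s2, s3⟩ := C.radial (lo := (a + η)/2) (p := η) (q := β) (hi := b) (by linarith) (by linarith)
    (by linarith) (by linarith) hβb hb
  obtain ⟨η', haη', hη'c, hη'⟩ := C.gap ha hac (by linarith) {y | (a + η)/2 ≤ C.τ (T.symm (Φ y))}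
    (isClosed_le continuous_const (C.hτ.comp (T.symm.continuous.comp Φ.continuous))) (by
      intro y hy
      change (a + η)/2 ≤ C.τ (T.symm (Φ y)) at hy
      by_contra h
      push Not at h
      rw [hΦa y h, homeo_fix T (hTa y h)] at hy
      linarith)
  obtain ⟨v, v1, v2, v3⟩ := C.radial (lo := (a + η')/2) (p := η') (q := c) (hi := c') (by linarith) (by linarith)
    (by linarith) (by linarith) hcc' (by linarith)
  have hlow : ∀ m, C.τ m < c → Φ (v (Φ.symm (T (s (T.symm (Φ (v.symm m))))))) = Φ m := by
    intro m hm
    have h1 : C.τ (v.symm m) < η' := by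
      rw [← not_le, v3, v.apply_symm_apply, not_le]; exact hm
    have h2 : C.τ (T.symm (Φ (v.symm m))) < (a + η)/2 := by
      by_contra h
      push Not at h
      have := hη' (v.symm m) h
      linarith
    rw [s1 _ h2.le]
    simp
  refine ⟨v.symm.trans (Φ.trans (T.symm.trans (s.trans (T.trans (Φ.symm.trans (v.trans Φ)))))), ?_, ?_, ?_, ?_⟩
  · intro m hm
    exact (hlow m (by linarith)).trans (hΦa m hm)
  · intro m hm
    have hbm := hA m hm
    show Φ (v (Φ.symm (T (s (T.symm (Φ (v.symm m))))))) = m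
    rw [homeo_fix v (v2 m (by linarith)), hΦA m hm, homeo_fix T (hTA m hm), s2 m hbm, hTA m hm,
      homeo_fix Φ (hΦA m hm), v2 m (by linarith), hΦA m hm]
  · intro m hm
    exact hlow m hm
  · intro m hm
    show Φ (v (Φ.symm (T (s (T.symm (Φ (v.symm m))))))) ∈ O n
    rw [homeo_fix v (v2 m hm)]
    have h1 : η ≤ C.τ (T.symm (Φ m)) := hη _ (by
      show c' ≤ C.τ (Φ.symm (T (T.symm (Φ m))))
      simpa using hm)
    have h2 := (s3 _).1 h1
    rw [v2 _ (hB _ h2).le, Φ.apply_symm_apply]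
    exact hOanti (le_max_left _ _) (hTO _ h2)

lemma lemD (C : CollarData M S) {a β b : ℝ} (ha : 0 < a) (hβb : β < b) (haβ : a < β) (hb : b < 1)
    (A : Set M) (hA : ∀ m ∈ A, b ≤ C.τ m) (O : ℕ → Set M) (hOc : ∀ n, IsClosed (O n))
    (hOanti : Antitone O) (hOA : ⋂ n, O n = A) (hO0 : ∀ m ∈ O 0, a ≤ C.τ m)
    (hT : ∀ n, ∃ T : M ≃ₜ M, (∀ m, C.τ m ≤ a → T m = m) ∧ (∀ m ∈ A, T m = m) ∧
      ∀ m, β ≤ C.τ m → T m ∈ O n) :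
    Nonempty (↥({m | a ≤ C.τ m} \ A) ≃ₜ S × ↥(Ici (0:ℝ))) := by
  classical
  have hab : a < b := by linarith
  let c : ℕ → ℝ := fun n => b - (b - a) / (n + 2)
  have hca : ∀ n, a < c n := by
    intro n
    have : (b - a) / ((n:ℝ) + 2) < b - a := div_lt_self (by linarith) (by have := n.cast_nonneg (α := ℝ); linarith)
    simp only [c]; linarith
  have hcb : ∀ n, c n < b := by
    intro n
    have : 0 < (b - a) / ((n:ℝ) + 2) := div_pos (by linarith) (by positivity)
    simp only [c]; linarith
  have hcmono : StrictMono c := by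
    apply strictMono_nat_of_lt_succ
    intro n
    have : (b - a) / (((n+1:ℕ):ℝ) + 2) < (b - a) / ((n:ℝ) + 2) := by
      apply div_lt_div_of_pos_left (by linarith) (by positivity)
      push_cast; linarith
    simp only [c]; linarith
  have hclim : ∀ t < b, ∃ n, t < c n := by
    intro t ht
    obtain ⟨n, hn⟩ := exists_nat_gt ((b - a) / (b - t))
    refine ⟨n, ?_⟩
    have h1 : (b - a) / ((n:ℝ) + 2) < b - t := by
      rw [div_lt_iff₀ (by positivity)]
      rw [div_lt_iff₀ (by linarith)] at hn
      nlinarith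
    simp only [c]; linarith
  let Good := {Φ : M ≃ₜ M // (∀ m, C.τ m ≤ a → Φ m = m) ∧ ∀ m ∈ A, Φ m = m}
  have hstep : ∀ (n : ℕ) (Φ : Good), ∃ Φ' : Good, (∀ m, C.τ m < c n → Φ'.1 m = Φ.1 m) ∧
      ∀ m, c (n+1) ≤ C.τ m → Φ'.1 m ∈ O n := by
    intro n Φ
    obtain ⟨Φ', h1, h2, h3, h4⟩ := lemD_step C ha hβb haβ hb A hA O hOc hOanti hOA hO0 hT Φ.1 Φ.2.1 Φ.2.2
      (hca n) (hcmono (Nat.lt_succ_self n)) (hcb (n+1)) n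
    exact ⟨⟨Φ', h1, h2⟩, h3, h4⟩
  choose nxt hn1 hn2 using hstep
  let Φs : ℕ → Good := fun n => Nat.rec ⟨Homeomorph.refl M, fun _ _ => rfl, fun _ _ => rfl⟩ (fun n Φ => nxt n Φ) n
  have hs1 : ∀ n m, C.τ m < c n → (Φs (n+1)).1 m = (Φs n).1 m := fun n m hm => hn1 n (Φs n) m hm
  have hs2 : ∀ n m, c (n+1) ≤ C.τ m → (Φs (n+1)).1 m ∈ O n := fun n m hm => hn2 n (Φs n) m hm
  have hst : ∀ n k m, n ≤ k → C.τ m < c n → (Φs k).1 m = (Φs n).1 m := by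
    intro n k m hnk hm
    induction k, hnk using Nat.le_induction with
    | base => rfl
    | succ k hk ih =>
      rw [hs1 k m (hm.trans_le (hcmono.monotone hk)), ih]
  -- forward map
  let F : M → M := fun m => if h : ∃ n, C.τ m < c n then (Φs h.choose).1 m else m
  have hF : ∀ n m, C.τ m < c n → F m = (Φs n).1 m := by
    intro n m hm
    have h : ∃ n, C.τ m < c n := ⟨n, hm⟩
    simp only [F, dif_pos h]
    rcases le_total n h.choose with h1 | h1
    · exact hst _ _ m h1 hm
    · exact (hst _ _ m h1 h.choose_spec).symm
  -- backward map
  have hlt : ∀ n y, y ∉ O n → C.τ ((Φs (n+1)).1.symm y) < c (n+1) := by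
    intro n y hy
    by_contra h
    push Not at h
    have := hs2 n _ h
    rw [Homeomorph.apply_symm_apply] at this
    exact hy this
  have hGst : ∀ n k y, n + 1 ≤ k → y ∉ O n → (Φs k).1.symm y = (Φs (n+1)).1.symm y := by
    intro n k y hk hy
    rw [Homeomorph.symm_apply_eq, hst (n+1) k _ hk (hlt n y hy), Homeomorph.apply_symm_apply]
  let G : M → M := fun y => if h : ∃ n, y ∉ O n then (Φs (h.choose + 1)).1.symm y else y
  have hG : ∀ n y, y ∉ O n → G y = (Φs (n+1)).1.symm y := by
    intro n y hy
    have h : ∃ n, y ∉ O n := ⟨n, hy⟩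
    simp only [G, dif_pos h]
    rcases le_total n h.choose with h1 | h1
    · exact hGst n (h.choose+1) y (by omega) hy
    · exact (hGst h.choose (n+1) y (by omega) h.choose_spec).symm
  have hAn : ∀ y, y ∉ A → ∃ n, y ∉ O n := by
    intro y hy
    rw [← hOA] at hy
    simpa using hy
  have hFc : ContinuousOn F {m | C.τ m < b} := by
    intro m hm
    obtain ⟨n, hn⟩ := hclim _ hm
    apply ContinuousAt.continuousWithinAt
    apply (Φs n).1.continuous.continuousAt.congr
    filter_upwards [(isOpen_Iio.preimage C.hτ).mem_nhds (show m ∈ C.τ ⁻¹' Iio (c n) from hn)] with y hy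
    exact (hF n y hy).symm
  have hGc : ContinuousOn G Aᶜ := by
    intro m hm
    obtain ⟨n, hn⟩ := hAn _ hm
    apply ContinuousAt.continuousWithinAt
    apply (Φs (n+1)).1.symm.continuous.continuousAt.congr
    filter_upwards [(hOc n).isOpen_compl.mem_nhds hn] with y hy
    exact (hG n y hy).symm
  have hGF : ∀ m, C.τ m < b → F m ∉ A ∧ G (F m) = m := by
    intro m hm
    obtain ⟨n, hn⟩ := hclim _ hm
    have h1 : F m ∉ A := by
      intro h
      rw [hF n m hn] at h
      have h2 := (Φs n).1.injective ((Φs n).2.2 _ h)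
      rw [h2] at h
      have := hA _ h
      linarith
    refine ⟨h1, ?_⟩
    obtain ⟨k, hk⟩ := hAn _ h1
    have h3 : F m ∉ O (max n k) := fun h => hk (hOanti (le_max_right _ _) h)
    rw [hG _ _ h3, Homeomorph.symm_apply_eq]
    refine hF (max n k + 1) m ?_
    exact hn.trans_le (hcmono.monotone (by have := le_max_left n k; omega))
  have hFG : ∀ y, y ∉ A → C.τ (G y) < b ∧ F (G y) = y := by
    intro y hy
    obtain ⟨n, hn⟩ := hAn _ hy
    have h1 := hlt n y hn
    rw [hG n y hn]
    refine ⟨h1.trans (hcb _), ?_⟩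
    rw [hF _ _ h1, Homeomorph.apply_symm_apply]
  have hFa : ∀ m, a ≤ C.τ m → C.τ m < b → a ≤ C.τ (F m) := by
    intro m hm hmb
    obtain ⟨n, hn⟩ := hclim _ hmb
    by_contra h
    push Not at h
    rw [hF n m hn] at h
    have h2 := (Φs n).1.injective ((Φs n).2.1 _ h.le)
    rw [h2] at h
    linarith
  have hGa : ∀ y, a ≤ C.τ y → y ∉ A → a ≤ C.τ (G y) := by
    intro y hy hyA
    obtain ⟨n, hn⟩ := hAn _ hyA
    by_contra h
    push Not at h
    rw [hG n y hn] at h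
    have h2 := (Φs (n+1)).2.1 _ h.le
    rw [Homeomorph.apply_symm_apply] at h2
    rw [← h2] at h
    linarith
  let r2t : ℝ → ℝ := fun r => (a + r * b) / (1 + r)
  let t2r : ℝ → ℝ := fun t => (t - a) / (b - t)
  have hr1 : ∀ r, 0 ≤ r → a ≤ r2t r ∧ r2t r < b := by
    intro r hr
    constructor
    · simp only [r2t]; rw [le_div_iff₀ (by linarith)]; nlinarith
    · simp only [r2t]; rw [div_lt_iff₀ (by linarith)]; nlinarith
  have hr2 : ∀ t, a ≤ t → t < b → 0 ≤ t2r t := fun t h1 h2 => div_nonneg (by linarith) (by linarith)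
  have hr3 : ∀ r, 0 ≤ r → t2r (r2t r) = r := by
    intro r hr
    have h1 : 1 + r ≠ 0 := by linarith
    have h2 : b - a ≠ 0 := by linarith
    have e1 : r2t r - a = r * (b - a) / (1 + r) := by simp only [r2t]; field_simp; ring
    have e2 : b - r2t r = (b - a) / (1 + r) := by simp only [r2t]; field_simp; ring
    simp only [t2r, e1, e2]
    field_simp
  have hr4 : ∀ t, a ≤ t → t < b → r2t (t2r t) = t := by
    intro t h1 h2
    have h3 : b - t ≠ 0 := by linarith
    have h4 : b - a ≠ 0 := by linarith
    have e1 : 1 + t2r t = (b - a) / (b - t) := by simp only [t2r]; field_simp; ring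
    have e2 : a + t2r t * b = t * (b - a) / (b - t) := by simp only [t2r]; field_simp; ring
    simp only [r2t, e1, e2]
    field_simp
  have hIoo : ∀ t, a ≤ t → t < b → t ∈ Ioo (0:ℝ) 1 := fun t h1 h2 => ⟨by linarith, by linarith⟩
  refine ⟨{
    toFun := fun y => (C.p (G y), ⟨t2r (C.τ (G y)), hr2 _ (hGa y y.2.1 y.2.2) (hFG y y.2.2).1⟩)
    invFun := fun q => ⟨F (C.c (q.1, r2t q.2)), by
      have h := hr1 q.2 q.2.2
      have h' := C.τc q.1 _ (hIoo _ h.1 h.2)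
      exact ⟨hFa _ (by rw [h']; exact h.1) (by rw [h']; exact h.2), (hGF _ (by rw [h']; exact h.2)).1⟩⟩
    left_inv := ?_
    right_inv := ?_
    continuous_toFun := ?_
    continuous_invFun := ?_ }⟩
  · intro y
    apply Subtype.ext
    have h1 := hGa y y.2.1 y.2.2
    have h2 := hFG y y.2.2
    simp only
    rw [hr4 _ h1 h2.1, C.cp _ (hIoo _ h1 h2.1), h2.2]
  · rintro ⟨x, r, hr⟩
    have h := hr1 r hr
    have h' := C.τc x _ (hIoo _ h.1 h.2)
    have h2 := (hGF (C.c (x, r2t r)) (by rw [h']; exact h.2)).2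
    apply Prod.ext
    · simp only
      rw [h2, C.pc x _ (hIoo _ h.1 h.2)]
    · apply Subtype.ext
      simp only
      rw [h2, h', hr3 r hr]
  · have hGs : Continuous (fun y : ↥({m | a ≤ C.τ m} \ A) => G y) :=
      hGc.comp_continuous continuous_subtype_val (fun y => y.2.2)
    apply Continuous.prodMk
    · exact C.hp.comp_continuous hGs (fun y => hIoo _ (hGa y y.2.1 y.2.2) (hFG y y.2.2).1)
    · apply Continuous.subtype_mk
      have h3 := C.hτ.comp hGs
      exact (h3.sub continuous_const).div (continuous_const.sub h3) (fun y => by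
        have := (hFG y y.2.2).1
        show b - C.τ (G y) ≠ 0
        linarith)
  · apply Continuous.subtype_mk
    have hr : Continuous (fun q : S × ↥(Ici (0:ℝ)) => r2t q.2) := by
      apply Continuous.div (by fun_prop) (by fun_prop)
      intro q
      have : (0:ℝ) ≤ q.2 := q.2.2
      linarith
    apply hFc.comp_continuous
    · apply C.hc.comp_continuous (continuous_fst.prodMk hr)
      intro q
      have h := hr1 q.2 q.2.2
      exact ⟨mem_univ _, hIoo _ h.1 h.2⟩
    · intro q
      have h := hr1 q.2 q.2.2
      show C.τ (C.c (q.1, r2t q.2)) < b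
      rw [C.τc _ _ (hIoo _ h.1 h.2)]
      exact h.2

end LemmaD

section TwoSides
variable {M S : Type*} [TopologicalSpace M] [T2Space M] [TopologicalSpace S] [CompactSpace S]

lemma outer_side (C : CollarData M S) (g : M ≃ₜ M) {a β b : ℝ} (ha : 0 < a) (haβ : a < β) (hβb : β < b)
    (hb : b < 1) (hg1 : ∀ m, a ≤ C.τ m → a < C.τ (g m))
    (hβ : ∀ m, β ≤ C.τ m → a < C.τ (g.symm m))
    (hk : ∃ k : ℕ, ∀ m, a ≤ C.τ m → b ≤ C.τ (g^[k] m)) :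
    Nonempty (↥({m | a ≤ C.τ m} \ {m | ∀ n : ℕ, a ≤ C.τ (g.symm^[n] m)}) ≃ₜ S × ↥(Ici (0:ℝ))) := by
  set A := {m | ∀ n : ℕ, a ≤ C.τ (g.symm^[n] m)} with hAdef
  let O : ℕ → Set M := fun n => {m | a ≤ C.τ (g.symm^[n] m)}
  obtain ⟨α, haα, hαβ, hα⟩ := C.gap ha haβ (by linarith) (g.symm '' {m | β ≤ C.τ m})
    ((g.symm.isClosedMap) _ (isClosed_le continuous_const C.hτ))
    (by rintro _ ⟨m, hm, rfl⟩; exact hβ m hm)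
  have hα' : ∀ m, β ≤ C.τ m → α ≤ C.τ (g.symm m) := fun m hm => hα _ ⟨m, hm, rfl⟩
  obtain ⟨θ, θ1, θ2, θ3⟩ := C.radial ha haα (show α < b by linarith) haβ hβb hb
  have hlow : ∀ m, C.τ m ≤ a → C.τ (g.symm m) < a := by
    intro m hm
    by_contra h
    push Not at h
    have := hg1 _ h
    rw [g.apply_symm_apply] at this
    linarith
  have hAb : ∀ m ∈ A, b ≤ C.τ m := by
    intro m hm
    obtain ⟨k, hk⟩ := hk
    have := hk _ (hm k)
    rwa [(Function.LeftInverse.iterate (f := g.symm) (g := g) g.apply_symm_apply k) m] at this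
  have hAg : ∀ m ∈ A, g.symm m ∈ A := fun m hm n => hm (n+1)
  refine lemD C ha (β := α) (by linarith) haα hb A hAb O ?_ ?_ ?_ ?_ ?_
  · intro n
    exact isClosed_le continuous_const (C.hτ.comp (g.symm.continuous.iterate n))
  · apply antitone_nat_of_succ_le
    intro n m hm
    have hm' : a ≤ C.τ (g.symm^[n+1] m) := hm
    rw [Function.iterate_succ_apply'] at hm'
    have := hg1 _ hm'
    rw [g.apply_symm_apply] at this
    exact this.le
  · ext m; simp [O, A]
  · intro m hm; exact hm
  · intro n
    suffices h : ∃ T : M ≃ₜ M, (∀ m, C.τ m ≤ a → T m = m) ∧ (∀ m ∈ A, T m = m) ∧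
      ∀ m, α ≤ C.τ m → β ≤ C.τ (g.symm^[n] (T m)) by
      obtain ⟨T, h1, h2, h3⟩ := h
      refine ⟨T, h1, h2, fun m hm => ?_⟩
      exact haβ.le.trans (h3 m hm)
    induction n with
    | zero => exact ⟨θ, θ1, fun m hm => θ2 m (hAb m hm), fun m hm => (θ3 m).1 hm⟩
    | succ n ih =>
      obtain ⟨T, h1, h2, h3⟩ := ih
      refine ⟨((θ.trans g.symm).trans T).trans g, ?_, ?_, ?_⟩
      · intro m hm
        show g (T (g.symm (θ m))) = m
        rw [θ1 m hm, h1 _ (hlow m hm).le, g.apply_symm_apply]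
      · intro m hm
        show g (T (g.symm (θ m))) = m
        rw [θ2 m (hAb m hm), h2 _ (hAg m hm), g.apply_symm_apply]
      · intro m hm
        show β ≤ C.τ (g.symm^[n+1] (g (T (g.symm (θ m)))))
        rw [Function.iterate_succ_apply, g.symm_apply_apply]
        exact h3 _ (hα' _ ((θ3 m).1 hm))

/-- iterate as a homeomorphism -/
def homeoIter {M : Type*} [TopologicalSpace M] (g : M ≃ₜ M) : ℕ → (M ≃ₜ M)
  | 0 => Homeomorph.refl M
  | n+1 => g.trans (homeoIter g n)

lemma homeoIter_apply {M : Type*} [TopologicalSpace M] (g : M ≃ₜ M) (n : ℕ) : ⇑(homeoIter g n) = g^[n] := by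
  induction n with
  | zero => rfl
  | succ n ih => funext x; rw [Function.iterate_succ_apply, ← ih]; rfl

lemma homeoIter_symm_apply {M : Type*} [TopologicalSpace M] (g : M ≃ₜ M) (n : ℕ) :
    ⇑(homeoIter g n).symm = g.symm^[n] := by
  funext x
  rw [Homeomorph.symm_apply_eq, homeoIter_apply]
  exact ((Function.LeftInverse.iterate (f := g.symm) (g := g) g.apply_symm_apply n) x).symm

lemma inner_side (C : CollarData M S) (g : M ≃ₜ M) {a β s s2 : ℝ} (ha : 0 < a) (haβ : a < β) (hβs : β < s)
    (hs : s < s2) (hs2 : s2 < 1) (hg : ∀ m, C.τ m ≤ s2 → C.τ (g.symm m) < s)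
    (hsm1 : ∀ n : ℕ, ∀ ε > 0, ∃ r > 0, ∀ m, C.τ m ≤ r → C.τ (g^[n] m) < ε)
    (hsm2 : ∀ n : ℕ, ∀ ε > 0, ∃ r > 0, ∀ m, C.τ m ≤ r → C.τ (g.symm^[n] m) < ε) :
    Nonempty (↥({m | a ≤ C.τ m} \ {m | ∀ n : ℕ, s ≤ C.τ (g.symm^[n] m)}) ≃ₜ S × ↥(Ici (0:ℝ))) := by
  set A := {m | ∀ n : ℕ, s ≤ C.τ (g.symm^[n] m)} with hAdef
  let O : ℕ → Set M := fun n => {m | s ≤ C.τ (g.symm^[n] m)}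
  have hanti : Antitone O := by
    apply antitone_nat_of_succ_le
    intro n m hm
    have hm' : s ≤ C.τ (g.symm^[n+1] m) := hm
    rw [Function.iterate_succ_apply'] at hm'
    show s ≤ C.τ (g.symm^[n] m)
    by_contra h
    push Not at h
    have := hg _ (show C.τ (g.symm^[n] m) ≤ s2 by linarith)
    linarith
  refine lemD C ha hβs haβ (by linarith) A (fun m hm => hm 0) O ?_ hanti ?_ ?_ ?_
  · intro n
    exact isClosed_le continuous_const (C.hτ.comp (g.symm.continuous.iterate n))
  · ext m; simp [O, A]
  · intro m hm
    have : s ≤ C.τ m := hm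
    linarith
  · intro n
    obtain ⟨r0, hr0, hr0'⟩ := hsm1 n β (by linarith)
    let r := min r0 (s/2)
    have hr : 0 < r := lt_min hr0 (by linarith)
    have hrs : r ≤ s/2 := min_le_right _ _
    have hr' : ∀ m, C.τ m ≤ r → C.τ (g^[n] m) < β := fun m hm => hr0' m (hm.trans (min_le_left _ _))
    obtain ⟨x, x1, x2, x3⟩ := C.radial (lo := r/2) (p := r) (q := (s+s2)/2) (hi := s2)
      (by linarith) (by linarith) (by linarith) (by linarith) (by linarith) hs2
    obtain ⟨r1, hr1, hr1'⟩ := hsm2 n (r/2) (by linarith)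
    let r3 := min r1 (a/2)
    have hr3 : 0 < r3 := lt_min hr1 (by linarith)
    have hr3a : r3 ≤ a/2 := min_le_right _ _
    obtain ⟨w, w1, w2, w3⟩ := C.radial (lo := r3/2) (p := r3) (q := (a+β)/2) (hi := β)
      (by linarith) (by linarith) (by linarith) (by linarith) (by linarith) (by linarith)
    have e1 : ∀ m, g^[n] (g.symm^[n] m) = m :=
      Function.LeftInverse.iterate (f := g.symm) (g := g) g.apply_symm_apply n
    have e2 : ∀ m, g.symm^[n] (g^[n] m) = m :=
      Function.LeftInverse.iterate (f := g) (g := g.symm) g.symm_apply_apply n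
    let T := ((homeoIter g n).symm.trans x).trans (homeoIter g n)
    have hT : ∀ m, T m = g^[n] (x (g.symm^[n] m)) := by
      intro m
      show (homeoIter g n) (x ((homeoIter g n).symm m)) = _
      rw [homeoIter_symm_apply, homeoIter_apply]
    have hTl : ∀ m, C.τ m ≤ r3 → T m = m := by
      intro m hm
      rw [hT, x1 _ (hr1' m (hm.trans (min_le_left _ _))).le, e1]
    have hTA : ∀ m ∈ A, T m = m := by
      intro m hm
      rw [hT, x2, e1]
      have h := hm (n+1)
      rw [Function.iterate_succ_apply'] at h
      by_contra hc
      push Not at hc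
      have := hg _ hc.le
      linarith
    have hTO : ∀ m, β ≤ C.τ m → T m ∈ O n := by
      intro m hm
      show s ≤ C.τ (g.symm^[n] (T m))
      rw [hT, e2]
      have h1 : r ≤ C.τ (g.symm^[n] m) := by
        by_contra hc
        push Not at hc
        have := hr' _ hc.le
        rw [e1] at this
        linarith
      have := (x3 _).1 h1
      linarith
    refine ⟨(w.symm.trans T).trans w, ?_, ?_, ?_⟩
    · intro m hm
      show w (T (w.symm m)) = m
      rw [hTl, w.apply_symm_apply]
      by_contra hc
      push Not at hc
      have := (w3 _).1 hc.le
      rw [w.apply_symm_apply] at this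
      linarith
    · intro m hm
      show w (T (w.symm m)) = m
      have h : s ≤ C.τ m := hm 0
      rw [homeo_fix w (w2 m (by linarith)), hTA m hm, w2 m (by linarith)]
    · intro m hm
      show w (T (w.symm m)) ∈ O n
      have h1 := hTO m hm
      have h2 : s ≤ C.τ (T m) := hanti (Nat.zero_le n) h1
      rw [homeo_fix w (w2 m hm), w2 _ (by linarith)]
      exact h1

end TwoSides

section Dyn
variable {M : Type*} [MetricSpace M]

/-- tail closures -/
def tailE (f : M ≃ₜ M) (U : Set M) (n : ℕ) : Set M := closure (⋃ (k : ℕ) (_ : n ≤ k), f^[k] '' U)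

lemma tailE_anti (f : M ≃ₜ M) (U : Set M) : Antitone (tailE f U) := by
  intro n k hnk
  apply closure_mono
  intro x hx
  simp only [mem_iUnion] at hx ⊢
  obtain ⟨i, hi, hx⟩ := hx
  exact ⟨i, hnk.trans hi, hx⟩

lemma omega_eq (f : M ≃ₜ M) (U : Set M) : omegaSet f U = ⋂ n, tailE f U (n+1) := by
  ext x
  simp only [omegaSet, mem_iInter]
  constructor
  · intro h n
    exact h (n+1) (by omega)
  · intro h n hn
    have := h (n-1)
    rwa [Nat.sub_add_cancel hn] at this

lemma tailE_image (f : M ≃ₜ M) (U : Set M) (n : ℕ) : f '' tailE f U n = tailE f U (n+1) := by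
  rw [tailE, Homeomorph.image_closure, tailE]
  congr 1
  ext x
  simp only [mem_iUnion, mem_image]
  constructor
  · rintro ⟨y, ⟨k, hk, z, hz, rfl⟩, rfl⟩
    exact ⟨k+1, by omega, z, hz, Function.iterate_succ_apply' _ _ _⟩
  · rintro ⟨k, hk, z, hz, rfl⟩
    refine ⟨f^[k-1] z, ⟨k-1, by omega, z, hz, rfl⟩, ?_⟩
    rw [← Function.iterate_succ_apply' f, Nat.succ_eq_add_one, Nat.sub_add_cancel (by omega)]

lemma omega_image (f : M ≃ₜ M) (U : Set M) : f '' omegaSet f U = omegaSet f U := by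
  rw [omega_eq, image_iInter f.bijective]
  simp only [tailE_image]
  apply Subset.antisymm
  · intro x hx
    simp only [mem_iInter] at hx ⊢
    exact fun n => tailE_anti f U (by omega) (hx n)
  · intro x hx
    simp only [mem_iInter] at hx ⊢
    exact fun n => hx (n+1)

lemma iter_mem_of_image {f : M ≃ₜ M} {K : Set M} (h : f '' K = K) (n : ℕ) {x : M} (hx : x ∈ K) :
    f^[n] x ∈ K := by
  induction n with
  | zero => exact hx
  | succ n ih =>
    rw [Function.iterate_succ_apply', ← h]
    exact mem_image_of_mem _ ih

lemma symm_image_of_image {f : M ≃ₜ M} {K : Set M} (h : f '' K = K) : f.symm '' K = K := by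
  conv_lhs => rw [← h]
  rw [image_image]
  simp

lemma att_lemma [LocallyCompactSpace M] (f : M ≃ₜ M) (K : Set M) (h : IsAttractor f K) :
    f '' K = K ∧ ∃ V ∈ 𝓝ˢ K, ∀ O, IsOpen O → K ⊆ O → ∃ n0 : ℕ, ∀ n ≥ n0, ∀ x ∈ V, f^[n] x ∈ O := by
  obtain ⟨hKc, U, hU, hKU⟩ := h
  have hinv : f '' K = K := by rw [hKU]; exact omega_image f U
  refine ⟨hinv, ?_⟩
  obtain ⟨V, hV, hKV, hVU⟩ := exists_compact_between hKc isOpen_interior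
    (subset_interior_iff_mem_nhdsSet.2 hU)
  have hVU' : V ⊆ U := hVU.trans interior_subset
  have hE : ∀ n k, n ≤ k → ∀ x ∈ U, f^[k] x ∈ tailE f U n := by
    intro n k hnk x hx
    apply subset_closure
    simp only [mem_iUnion]
    exact ⟨k, hnk, x, hx, rfl⟩
  have key : ∀ D : Set M, IsCompact D → D ∩ K = ∅ → ∃ n, D ∩ tailE f U n = ∅ := by
    intro D hD hDK
    rw [hKU, omega_eq] at hDK
    obtain ⟨n, hn⟩ := hD.elim_directed_family_closed (fun n => tailE f U (n+1))
      (fun n => isClosed_closure) hDK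
      (fun i j => ⟨max i j, tailE_anti f U (by have := le_max_left i j; omega),
        tailE_anti f U (by have := le_max_right i j; omega)⟩)
    exact ⟨n+1, hn⟩
  obtain ⟨n0, hn0⟩ := key (f '' V \ interior V) ((hV.image f.continuous).diff isOpen_interior) (by
    rw [eq_empty_iff_forall_notMem]
    rintro x ⟨⟨_, hx⟩, hxK⟩
    exact hx (hKV hxK))
  let V1 : Set M := ⋂ i ∈ Finset.range (n0+1), f^[i] ⁻¹' V
  have hV1 : V1 ∈ 𝓝ˢ K := by
    rw [mem_nhdsSet_iff_forall]
    intro x hx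
    rw [Filter.biInter_finset_mem]
    intro i _
    apply (f.continuous.iterate i).continuousAt.preimage_mem_nhds
    exact mem_interior_iff_mem_nhds.1 (hKV (iter_mem_of_image hinv i hx))
  have hstay : ∀ x ∈ V1, ∀ i, f^[i] x ∈ V := by
    intro x hx i
    have hx' : ∀ i ≤ n0, f^[i] x ∈ V := by
      intro i hi
      simp only [V1, mem_iInter] at hx
      exact hx i (Finset.mem_range.2 (by omega))
    have hxU : x ∈ U := hVU' (hx' 0 (Nat.zero_le _))
    induction i with
    | zero => exact hx' 0 (Nat.zero_le _)
    | succ i ih =>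
      by_cases hi : i + 1 ≤ n0
      · exact hx' _ hi
      · by_contra hc
        have : f^[i+1] x ∈ (f '' V \ interior V) ∩ tailE f U n0 := by
          refine ⟨⟨⟨_, ih, (Function.iterate_succ_apply' f i x).symm⟩, fun h => hc (interior_subset h)⟩, ?_⟩
          exact hE _ _ (by omega) x hxU
        rw [hn0] at this
        exact this
  refine ⟨V1, hV1, ?_⟩
  intro O hO hKO
  obtain ⟨n1, hn1⟩ := key (V \ O) (hV.diff hO) (by
    rw [eq_empty_iff_forall_notMem]
    rintro x ⟨⟨_, hx⟩, hxK⟩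
    exact hx (hKO hxK))
  refine ⟨n1, fun n hn x hx => ?_⟩
  by_contra hc
  have : f^[n] x ∈ (V \ O) ∩ tailE f U n1 :=
    ⟨⟨hstay x hx n, hc⟩, hE _ _ hn x (hVU' (hstay x hx 0))⟩
  rw [hn1] at this
  exact this

lemma att_crit (f : M ≃ₜ M) (K C : Set M) (hK : IsCompact K) (hinv : f '' K = K) (hC : C ∈ 𝓝ˢ K)
    (h : ∀ O, IsOpen O → K ⊆ O → ∃ n0 : ℕ, ∀ n ≥ n0, ∀ x ∈ C, f^[n] x ∈ O) : IsAttractor f K := by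
  refine ⟨hK, C, hC, ?_⟩
  rw [omega_eq]
  apply Subset.antisymm
  · intro x hx
    simp only [mem_iInter]
    intro n
    apply subset_closure
    simp only [mem_iUnion]
    refine ⟨n+1, le_rfl, f.symm^[n+1] x, ?_, ?_⟩
    · exact subset_of_mem_nhdsSet hC (iter_mem_of_image (symm_image_of_image hinv) (n+1) hx)
    · exact Function.LeftInverse.iterate (f := f.symm) (g := f) f.apply_symm_apply (n+1) x
  · intro x hx
    by_contra hxK
    obtain ⟨U, V, hU, hV, hKU, hxV, hd⟩ := SeparatedNhds.of_isCompact_isCompact hK isCompact_singleton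
      (Set.disjoint_singleton_right.2 hxK)
    obtain ⟨n0, hn0⟩ := h U hU hKU
    simp only [mem_iInter] at hx
    have h1 := hx n0
    rw [tailE, mem_closure_iff] at h1
    obtain ⟨y, hyV, hy⟩ := h1 V hV (hxV rfl)
    simp only [mem_iUnion] at hy
    obtain ⟨k, hk, z, hz, rfl⟩ := hy
    exact Set.disjoint_left.1 hd (hn0 k (by omega) z hz) hyV

/-- disjoint union homeomorphism -/
lemma sum_homeo {X : Type*} [TopologicalSpace X] (P Q R : Set X) (hR : R = P ∪ Q) (U V : Set X) (hU : IsOpen U) (hV : IsOpen V)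
    (hPU : P ⊆ U) (hQV : Q ⊆ V) (hPV : Disjoint P V) (hQU : Disjoint Q U) :
    Nonempty (↥P ⊕ ↥Q ≃ₜ ↥R) := by
  subst hR
  let φ : ↥P ⊕ ↥Q → ↥(P ∪ Q) := Sum.elim (inclusion subset_union_left) (inclusion subset_union_right)
  have hbij : Function.Bijective φ := by
    constructor
    · rintro (⟨x, hx⟩ | ⟨x, hx⟩) (⟨y, hy⟩ | ⟨y, hy⟩) h
      · have : x = y := congrArg Subtype.val h
        subst this; rfl
      · have : x = y := congrArg Subtype.val h
        subst this
        exact absurd (hPU hx) (Set.disjoint_left.1 hQU hy)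
      · have : x = y := congrArg Subtype.val h
        subst this
        exact absurd (hPU hy) (Set.disjoint_left.1 hQU hx)
      · have : x = y := congrArg Subtype.val h
        subst this; rfl
    · rintro ⟨x, hx | hx⟩
      · exact ⟨Sum.inl ⟨x, hx⟩, rfl⟩
      · exact ⟨Sum.inr ⟨x, hx⟩, rfl⟩
  have hcont : Continuous φ := (continuous_inclusion _).sumElim (continuous_inclusion _)
  have hopen : IsOpenMap φ := by
    apply IsOpenMap.sumElim
    · apply (IsEmbedding.inclusion subset_union_left).isInducing.isOpenMap
      have : range (inclusion (subset_union_left : P ⊆ P ∪ Q)) = Subtype.val ⁻¹' U := by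
        ext ⟨x, hx⟩
        simp only [range_inclusion, mem_preimage]
        constructor
        · intro h; exact hPU h
        · intro h
          rcases hx with hx | hx
          · exact hx
          · exact absurd h (Set.disjoint_left.1 hQU hx)
      rw [this]
      exact hU.preimage continuous_subtype_val
    · apply (IsEmbedding.inclusion subset_union_right).isInducing.isOpenMap
      have : range (inclusion (subset_union_right : Q ⊆ P ∪ Q)) = Subtype.val ⁻¹' V := by
        ext ⟨x, hx⟩
        simp only [range_inclusion, mem_preimage]
        constructor
        · intro h; exact hQV h
        · intro h
          rcases hx with hx | hx
          · exact absurd h (Set.disjoint_left.1 hPV hx)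
          · exact hx
      rw [this]
      exact hV.preimage continuous_subtype_val
  exact ⟨(Equiv.ofBijective φ hbij).toHomeomorphOfContinuousOpen hcont hopen⟩

/-- persistence -/
lemma persist (F : unitInterval × M → M) (hF : Continuous F) (N O : Set M) (hN : IsCompact N) (hO : IsOpen O)
    (h : ∀ x ∈ N, F (0, x) ∈ O) : ∃ ε > (0:ℝ), ∀ lam : unitInterval, (lam : ℝ) < ε → ∀ x ∈ N, F (lam, x) ∈ O := by
  have h1 : ∀ᶠ lam in 𝓝 (0 : unitInterval), ∀ x ∈ N, F (lam, x) ∈ O := by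
    apply hN.eventually_forall_of_forall_eventually
    intro y hy
    exact (hO.preimage hF).mem_nhds (h y hy)
  rw [Metric.eventually_nhds_iff] at h1
  obtain ⟨ε, hε, h1⟩ := h1
  refine ⟨ε, hε, fun lam hl => h1 ?_⟩
  rw [Subtype.dist_eq, Real.dist_eq]
  show |(lam : ℝ) - 0| < ε
  rwa [sub_zero, abs_of_nonneg lam.2.1]

lemma iter_cont (f : unitInterval → M ≃ₜ M) (hf : Continuous (fun p : unitInterval × M => f p.1 p.2)) (n : ℕ) :
    Continuous (fun p : unitInterval × M => (f p.1)^[n] p.2) := by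
  induction n with
  | zero => exact continuous_snd
  | succ n ih =>
    simp only [Function.iterate_succ_apply']
    exact hf.comp (continuous_fst.prodMk ih)

end Dyn

section Fixed
variable {M S : Type*} [MetricSpace M] [TopologicalSpace S] [CompactSpace S]

lemma level_homeo (C : CollarData M S) {t : ℝ} (ht : t ∈ Ioo (0:ℝ) 1) :
    Nonempty (S ≃ₜ ↥{m | C.τ m = t}) := by
  refine ⟨{
    toFun := fun x => ⟨C.c (x, t), C.τc x t ht⟩
    invFun := fun m => C.p m
    left_inv := fun x => C.pc x t ht
    right_inv := ?_
    continuous_toFun := ?_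
    continuous_invFun := ?_ }⟩
  · rintro ⟨m, hm⟩
    apply Subtype.ext
    have hm' : C.τ m = t := hm
    have := C.cp m (by rw [hm']; exact ht)
    rw [hm'] at this
    exact this
  · apply Continuous.subtype_mk
    exact C.hc.comp_continuous (continuous_id.prodMk continuous_const) (fun x => ⟨mem_univ _, ht⟩)
  · refine C.hp.comp_continuous continuous_subtype_val (fun m => ?_)
    have : C.τ m = t := m.2
    show C.τ m ∈ Ioo (0:ℝ) 1
    rw [this]; exact ht

lemma band_homeo (C : CollarData M S) {a b : ℝ} (ha : 0 < a) (hab : a < b) (hb : b < 1) :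
    Nonempty (↥{m | a ≤ C.τ m ∧ C.τ m ≤ b} ≃ₜ S × ↥(Icc (0:ℝ) 1)) := by
  have hba : 0 < b - a := by linarith
  have hI : ∀ t, a ≤ t → t ≤ b → t ∈ Ioo (0:ℝ) 1 := fun t h1 h2 => ⟨by linarith, by linarith⟩
  have hr : ∀ r : ↥(Icc (0:ℝ) 1), a ≤ a + r * (b - a) ∧ a + r * (b - a) ≤ b := by
    rintro ⟨r, h0, h1⟩
    constructor <;> simp only <;> nlinarith
  refine ⟨{
    toFun := fun m => (C.p m, ⟨(C.τ m - a) / (b - a), div_nonneg (by linarith [m.2.1]) hba.le,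
      (div_le_one hba).2 (by linarith [m.2.2])⟩)
    invFun := fun q => ⟨C.c (q.1, a + q.2 * (b - a)), by
      have h := hr q.2
      show a ≤ C.τ _ ∧ C.τ _ ≤ b
      rw [C.τc _ _ (hI _ h.1 h.2)]
      exact h⟩
    left_inv := ?_
    right_inv := ?_
    continuous_toFun := ?_
    continuous_invFun := ?_ }⟩
  · rintro ⟨m, hm⟩
    apply Subtype.ext
    simp only
    rw [div_mul_cancel₀ _ hba.ne', add_sub_cancel]
    exact C.cp m (hI _ hm.1 hm.2)
  · rintro ⟨x, r⟩
    have h := hr r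
    apply Prod.ext
    · exact C.pc _ _ (hI _ h.1 h.2)
    · apply Subtype.ext
      simp only
      rw [C.τc _ _ (hI _ h.1 h.2)]
      field_simp
      ring
  · apply Continuous.prodMk
    · exact C.hp.comp_continuous continuous_subtype_val (fun m => hI _ m.2.1 m.2.2)
    · apply Continuous.subtype_mk
      exact ((C.hτ.comp continuous_subtype_val).sub continuous_const).div_const _
  · apply Continuous.subtype_mk
    apply C.hc.comp_continuous
    · exact continuous_fst.prodMk (by fun_prop)
    · intro q
      have h := hr q.2
      exact ⟨mem_univ _, hI _ h.1 h.2⟩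

lemma level_frontier (C : CollarData M S) {t : ℝ} (ht : t ∈ Ioo (0:ℝ) 1) (O : Set M) (hO : IsOpen O) {m : M}
    (hm : m ∈ O) (hmt : C.τ m = t) : (∃ y ∈ O, C.τ y < t) ∧ ∃ y ∈ O, t < C.τ y := by
  have hc : ContinuousOn (fun s : ℝ => C.c (C.p m, s)) (Ioo 0 1) :=
    C.hc.comp (continuous_const.prodMk continuous_id).continuousOn (fun s hs => ⟨mem_univ _, hs⟩)
  have h1 : ContinuousAt (fun s : ℝ => C.c (C.p m, s)) t := hc.continuousAt (Ioo_mem_nhds ht.1 ht.2)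
  have h2 : C.c (C.p m, t) = m := by rw [← hmt]; exact C.cp m (by rw [hmt]; exact ht)
  have h3 : ∀ᶠ s in 𝓝 t, C.c (C.p m, s) ∈ O ∧ s ∈ Ioo (0:ℝ) 1 := by
    apply Filter.Eventually.and
    · apply h1.preimage_mem_nhds
      show O ∈ 𝓝 (C.c (C.p m, t))
      rw [h2]; exact hO.mem_nhds hm
    · exact Ioo_mem_nhds ht.1 ht.2
  obtain ⟨ε, hε, h4⟩ := Metric.eventually_nhds_iff.1 h3
  constructor
  · obtain ⟨h5, h6⟩ := h4 (y := t - ε/2) (by rw [Real.dist_eq, abs_lt]; constructor <;> linarith)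
    exact ⟨_, h5, by rw [C.τc _ _ h6]; linarith⟩
  · obtain ⟨h5, h6⟩ := h4 (y := t + ε/2) (by rw [Real.dist_eq, abs_lt]; constructor <;> linarith)
    exact ⟨_, h5, by rw [C.τc _ _ h6]; linarith⟩

lemma band_bdry (hM : LocallyEuclidean 3 M) (C : CollarData M S) {a b : ℝ} (ha : 0 < a) (hab : a < b) (hb : b < 1) :
    Nonempty (S ⊕ S ≃ₜ ↥(subsetBoundary 3 {m | a ≤ C.τ m ∧ C.τ m ≤ b})) := by
  have hE : subsetBoundary 3 {m | a ≤ C.τ m ∧ C.τ m ≤ b} = {m | C.τ m = a} ∪ {m | C.τ m = b} := by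
    rw [bdry_eq hM]
    ext m
    constructor
    · rintro ⟨⟨h1, h2⟩, h3⟩
      by_contra hc
      rw [mem_union, not_or] at hc
      apply h3
      have hop : IsOpen (C.τ ⁻¹' Ioo a b) := isOpen_Ioo.preimage C.hτ
      refine mem_interior.2 ⟨_, fun x hx => ⟨hx.1.le, hx.2.le⟩, hop, ?_⟩
      exact ⟨lt_of_le_of_ne h1 (fun h => hc.1 h.symm), lt_of_le_of_ne h2 (fun h => hc.2 h)⟩
    · rintro (h | h)
      · have h' : C.τ m = a := h
        refine ⟨⟨h'.ge, by linarith⟩, fun hi => ?_⟩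
        obtain ⟨⟨y, hy, hya⟩, _⟩ := level_frontier C ⟨ha, by linarith⟩ _ isOpen_interior hi h'
        exact absurd (interior_subset hy).1 (not_le.2 hya)
      · have h' : C.τ m = b := h
        refine ⟨⟨by linarith, h'.le⟩, fun hi => ?_⟩
        obtain ⟨_, ⟨y, hy, hya⟩⟩ := level_frontier C ⟨by linarith, hb⟩ _ isOpen_interior hi h'
        exact absurd (interior_subset hy).2 (not_le.2 hya)
  obtain ⟨e1⟩ := level_homeo C (t := a) ⟨ha, by linarith⟩
  obtain ⟨e2⟩ := level_homeo C (t := b) ⟨by linarith, hb⟩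
  obtain ⟨e3⟩ := sum_homeo _ _ _ hE (C.τ ⁻¹' Iio b) (C.τ ⁻¹' Ioi a) (isOpen_Iio.preimage C.hτ)
    (isOpen_Ioi.preimage C.hτ)
    (fun m (hm : C.τ m = a) => show C.τ m < b by linarith)
    (fun m (hm : C.τ m = b) => show a < C.τ m by linarith)
    (Set.disjoint_left.2 (fun m (hm : C.τ m = a) (h : a < C.τ m) => by linarith))
    (Set.disjoint_left.2 (fun m (hm : C.τ m = b) (h : C.τ m < b) => by linarith))
  exact ⟨(e1.sumCongr e2).trans e3⟩

/-- sublevels form a neighbourhood basis -/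
lemma sub_basis (C : CollarData M S) (K : Set M) (hτ0 : ∀ m, 0 ≤ C.τ m) (hK : K = {m | C.τ m ≤ 0})
    (hcomp : ∀ t < 1, IsCompact {m | C.τ m ≤ t}) (O : Set M) (hO : IsOpen O) (hKO : K ⊆ O) {e : ℝ} (he : 0 < e) :
    ∃ s, 0 < s ∧ s < e ∧ s < 1 ∧ ∀ m, C.τ m ≤ s → m ∈ O := by
  have hD : IsCompact ({m | C.τ m ≤ 1/2} \ O) := (hcomp _ (by norm_num)).diff hO
  have : ∃ r > 0, ∀ m ∈ {m | C.τ m ≤ 1/2} \ O, r ≤ C.τ m := by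
    rcases ({m | C.τ m ≤ 1/2} \ O).eq_empty_or_nonempty with h | h
    · exact ⟨1, one_pos, fun m hm => by rw [h] at hm; exact absurd hm (notMem_empty m)⟩
    · obtain ⟨x, hx, hmin⟩ := hD.exists_isMinOn h C.hτ.continuousOn
      refine ⟨C.τ x, ?_, fun m hm => hmin hm⟩
      by_contra hc
      push Not at hc
      exact hx.2 (hKO (by rw [hK]; exact hc))
  obtain ⟨r, hr, hr'⟩ := this
  refine ⟨min (min (r/2) (e/2)) (1/2), by positivity, ?_, ?_, ?_⟩
  · have := min_le_left (min (r/2) (e/2)) (1/2)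
    have := min_le_right (r/2) (e/2)
    linarith
  · have := min_le_right (min (r/2) (e/2)) (1/2)
    linarith
  · intro m hm
    by_contra hc
    have h1 := min_le_right (min (r/2) (e/2)) (1/2)
    have h2 := min_le_left (min (r/2) (e/2)) (1/2)
    have h3 := min_le_left (r/2) (e/2)
    have := hr' m ⟨show C.τ m ≤ 1/2 by linarith, hc⟩
    linarith

end Fixed

section Fixed2
variable {M S : Type*} [MetricSpace M] [LocallyCompactSpace M] [TopologicalSpace S] [CompactSpace S]

lemma fixed_lam (hM : LocallyEuclidean 3 M) (C : CollarData M S) (K : Set M) (hτ0 : ∀ m, 0 ≤ C.τ m)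
    (hK : K = {m | C.τ m ≤ 0}) (hcomp : ∀ t < 1, IsCompact {m | C.τ m ≤ t})
    (f : M ≃ₜ M) (hrep : IsAttractor f.symm K) {s1 δ : ℝ} (hδ : 0 < δ) (hδs : δ < s1) (hs1 : s1 < 1)
    (q k : ℕ) (hq : 1 ≤ q)
    (O1 : ∀ x, C.τ x ≤ s1 → C.τ (f^[q] x) < s1)
    (O2 : ∀ x, C.τ x ≤ δ → C.τ (f.symm^[q] x) < s1)
    (O3 : ∀ x, C.τ x ≤ s1 → C.τ (f^[q*k] x) < δ/2)
    (O4 : ∀ i ≤ q, ∀ x, C.τ x ≤ δ → C.τ (f^[i] x) < s1) :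
    ∃ Kl ⊆ {x | ∀ n : ℕ, C.τ (f.symm^[q*n] x) ≤ s1}, IsCompact Kl ∧ IsAttractor f Kl ∧
      ∃ Cc : Set M, IsCompact Cc ∧ Nonempty (↥Cc ≃ₜ S × ↥(Icc (0:ℝ) 1)) ∧ IsSpine 3 Cc Kl := by
  have e1 : ∀ (n : ℕ) x, f^[n] (f.symm^[n] x) = x := fun n =>
    Function.LeftInverse.iterate (f := f.symm) (g := f) f.apply_symm_apply n
  have e2 : ∀ (n : ℕ) x, f.symm^[n] (f^[n] x) = x := fun n =>
    Function.LeftInverse.iterate (f := f) (g := f.symm) f.symm_apply_apply n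
  have e3 : ∀ (n l : ℕ) x, l ≤ n → f^[l] (f.symm^[n] x) = f.symm^[n-l] x := by
    intro n l x h
    obtain ⟨d, rfl⟩ := Nat.exists_eq_add_of_le h
    rw [Function.iterate_add_apply, e1, Nat.add_sub_cancel_left]
  have e4 : ∀ (n l : ℕ) x, l ≤ n → f.symm^[l] (f^[n] x) = f^[n-l] x := by
    intro n l x h
    obtain ⟨d, rfl⟩ := Nat.exists_eq_add_of_le h
    rw [Function.iterate_add_apply, e2, Nat.add_sub_cancel_left]
  have e5 : ∀ (n l : ℕ) x, n ≤ l → f.symm^[l] (f^[n] x) = f.symm^[l-n] x := by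
    intro n l x h
    obtain ⟨d, rfl⟩ := Nat.exists_eq_add_of_le h
    rw [Nat.add_comm, Function.iterate_add_apply, e2, Nat.add_sub_cancel]
  set A := {x | ∀ n : ℕ, C.τ (f.symm^[q*n] x) ≤ s1} with hA
  have hAcl : IsClosed A := by
    rw [hA, ofPred_forall]
    exact isClosed_iInter (fun n => isClosed_le (C.hτ.comp (f.symm.continuous.iterate _)) continuous_const)
  have hAδ : ∀ x ∈ A, C.τ x < δ/2 := by
    intro x hx
    have := O3 _ (hx k)
    rwa [e1] at this
  have hAback : ∀ x ∈ A, ∀ n, f.symm^[q*n] x ∈ A := by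
    intro x hx n l
    rw [← Function.iterate_add_apply, ← Nat.mul_add]
    exact hx (l+n)
  have hAfw : ∀ i ≤ q, ∀ x ∈ A, f^[i] x ∈ A := by
    intro i hi x hx n
    have h1 := O4 i hi (f.symm^[q*n] x) (by have := hAδ _ (hAback x hx n); linarith)
    have h2 : f.symm^[q*n] (f^[i] x) = f^[i] (f.symm^[q*n] x) :=
      (Function.Commute.iterate_iterate (fun y => by simp) _ _ : Function.Commute (f.symm^[q*n]) (f^[i])) x
    rw [h2]; exact h1.le
  have hAf : ∀ x ∈ A, f x ∈ A := fun x hx => hAfw 1 hq x hx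
  have hAfi : ∀ n, ∀ x ∈ A, f^[n] x ∈ A := by
    intro n
    induction n with
    | zero => exact fun x hx => hx
    | succ n ih => intro x hx; rw [Function.iterate_succ_apply']; exact hAf _ (ih x hx)
  have hAs : ∀ x ∈ A, f.symm x ∈ A := by
    intro x hx
    have h1 := hAfw (q-1) (by omega) _ (hAback x hx 1)
    rw [Nat.mul_one, e3 _ _ _ (by omega)] at h1
    have h2 : q - (q-1) = 1 := by omega
    rw [h2] at h1
    exact h1
  -- repeller
  obtain ⟨hKinv, V, hV, hVatt⟩ := att_lemma f.symm K hrep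
  have hKinv' : f '' K = K := symm_image_of_image hKinv
  obtain ⟨s2, hs20, hs2s, hs21, hs2V⟩ := sub_basis C K hτ0 hK hcomp (interior V) isOpen_interior
    (subset_interior_iff_mem_nhdsSet.2 hV) (e := s1) (by linarith)
  obtain ⟨s, hs⟩ : ∃ s, s = s2/2 := ⟨_, rfl⟩
  have hss2 : s < s2 := by linarith
  have hs0 : 0 < s := by linarith
  have hopen : ∀ r : ℝ, IsOpen {m | C.τ m < r} := fun r => isOpen_lt C.hτ continuous_const
  have hback : ∀ r > 0, ∃ n0 : ℕ, ∀ n ≥ n0, ∀ x, C.τ x ≤ s2 → C.τ (f.symm^[n] x) < r := by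
    intro r hr
    obtain ⟨n0, h⟩ := hVatt {m | C.τ m < r} (hopen r) (by
      rw [hK]; intro m (hm : C.τ m ≤ 0); exact lt_of_le_of_lt hm hr)
    exact ⟨n0, fun n hn x hx => h n hn x (interior_subset (hs2V x hx))⟩
  obtain ⟨j0, hj0⟩ := hback s hs0
  obtain ⟨j, hj⟩ : ∃ j, j = max j0 1 := ⟨_, rfl⟩
  have hj1 : 1 ≤ j := by rw [hj]; exact le_max_right _ _
  have hjj0 : j0 ≤ j := by rw [hj]; exact le_max_left _ _
  have hjs : ∀ n ≥ j, ∀ x, C.τ x ≤ s2 → C.τ (f.symm^[n] x) < s := fun n hn => hj0 n (by omega)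
  let W : Set M := {x | ∃ n : ℕ, C.τ (f.symm^[n] x) < s}
  have hWlate : ∀ x ∈ W, ∃ n0, ∀ n ≥ n0, C.τ (f.symm^[n] x) < s := by
    rintro x ⟨n, hn⟩
    refine ⟨n + j, fun l hl => ?_⟩
    have := hjs (l - n) (by omega) (f.symm^[n] x) (by linarith)
    rwa [← Function.iterate_add_apply, Nat.sub_add_cancel (by omega)] at this
  have hWopen : IsOpen W := by
    have : W = ⋃ n : ℕ, {x | C.τ (f.symm^[n] x) < s} := by ext x; simp [W]
    rw [this]
    exact isOpen_iUnion (fun n => isOpen_lt (C.hτ.comp (f.symm.continuous.iterate n)) continuous_const)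
  have hWf : ∀ x, x ∈ W → f x ∈ W := by
    rintro x ⟨n, hn⟩
    refine ⟨n+1, ?_⟩
    rwa [Function.iterate_succ_apply, f.symm_apply_apply]
  have hWs : ∀ x, x ∈ W → f.symm x ∈ W := by
    intro x hx
    obtain ⟨n0, h⟩ := hWlate x hx
    exact ⟨n0, h (n0+1) (by omega)⟩
  have hWA : W ⊆ A := by
    intro x hx n
    obtain ⟨n0, h⟩ := hWlate x hx
    have hdown : ∀ d : ℕ, ∀ n : ℕ, C.τ (f.symm^[q*(n+d)] x) ≤ s1 → C.τ (f.symm^[q*n] x) ≤ s1 := by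
      intro d
      induction d with
      | zero => exact fun n h => h
      | succ d ih =>
        intro n h
        apply ih n
        have := O1 _ h
        rw [e3 _ _ _ (by rw [Nat.mul_add, Nat.mul_add]; omega)] at this
        have h2 : q * (n + (d+1)) - q = q * (n+d) := by
          rw [← Nat.add_assoc, Nat.mul_add q (n+d) 1]; omega
        rw [h2] at this
        exact this.le
    apply hdown n0 n
    have := h (q*(n+n0)) (by nlinarith)
    linarith
  obtain ⟨a, ha⟩ : ∃ a, a = s/3 := ⟨_, rfl⟩
  have ha0 : 0 < a := by linarith
  have has : a < s := by linarith
  have haW : ∀ x, C.τ x < s → x ∈ W := fun x hx => ⟨0, hx⟩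
  let Kl := A \ W
  let Cc : Set M := {m | a ≤ C.τ m ∧ C.τ m ≤ s1}
  have hKls : ∀ x ∈ Kl, s ≤ C.τ x := by
    intro x hx
    by_contra hc
    push Not at hc
    exact hx.2 (haW x hc)
  have hKlint : Kl ⊆ interior Cc := by
    intro x hx
    have hop : IsOpen (C.τ ⁻¹' Ioo a s1) := isOpen_Ioo.preimage C.hτ
    refine mem_interior.2 ⟨_, fun x hx => ⟨hx.1.le, hx.2.le⟩, hop, ?_⟩
    have h1 := hKls x hx
    have h2 := hAδ x hx.1
    exact ⟨by linarith, by linarith⟩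
  have hAcomp : IsCompact A := by
    apply (hcomp s1 hs1).of_isClosed_subset hAcl
    intro x hx
    exact hx 0
  have hKlc : IsCompact Kl := hAcomp.diff hWopen
  have hKlinv : f '' Kl = Kl := by
    apply Subset.antisymm
    · rintro _ ⟨x, hx, rfl⟩
      refine ⟨hAf x hx.1, fun h => hx.2 ?_⟩
      have := hWs _ h
      rwa [f.symm_apply_apply] at this
    · intro x hx
      refine ⟨f.symm x, ⟨hAs x hx.1, fun h => hx.2 ?_⟩, f.apply_symm_apply x⟩
      have := hWf _ h
      rwa [f.apply_symm_apply] at this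
  -- attraction of the big neighbourhood to A
  have hattA : ∀ O, IsOpen O → A ⊆ O → ∃ n0 : ℕ, ∀ n ≥ n0, ∀ x, C.τ x ≤ s1 → f^[n] x ∈ O := by
    intro O hO hAO
    let O' : Set M := ⋂ r ∈ Finset.range q, f^[r] ⁻¹' O
    have hO' : IsOpen O' := isOpen_biInter_finset (fun r _ => hO.preimage (f.continuous.iterate r))
    have hAO' : A ⊆ O' := by
      intro x hx
      simp only [O', mem_iInter]
      exact fun r _ => hAO (hAfi r x hx)
    let B : ℕ → Set M := fun n => {x | C.τ (f.symm^[q*n] x) ≤ s1}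
    have hBanti : Antitone B := by
      apply antitone_nat_of_succ_le
      intro n x hx
      have := O1 _ hx
      rw [e3 _ _ _ (by rw [Nat.mul_add]; omega)] at this
      have h2 : q * (n+1) - q = q * n := by rw [Nat.mul_add]; omega
      rw [h2] at this
      exact this.le
    obtain ⟨n, hn⟩ := ((hcomp s1 hs1).diff hO').elim_directed_family_closed B
      (fun n => isClosed_le (C.hτ.comp (f.symm.continuous.iterate _)) continuous_const)
      (by
        rw [eq_empty_iff_forall_notMem]
        rintro x ⟨hx, hx2⟩
        apply hx.2
        apply hAO'
        simp only [mem_iInter] at hx2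
        exact hx2)
      (fun i j => ⟨max i j, hBanti (le_max_left _ _), hBanti (le_max_right _ _)⟩)
    have hBO : ∀ x ∈ B n, x ∈ O' := by
      intro x hx
      by_contra hc
      have : x ∈ ({m | C.τ m ≤ s1} \ O') ∩ B n := ⟨⟨hBanti (Nat.zero_le n) hx, hc⟩, hx⟩
      rw [hn] at this
      exact this
    have hiter : ∀ l x, C.τ x ≤ s1 → C.τ (f^[q*l] x) ≤ s1 := by
      intro l
      induction l with
      | zero => exact fun x hx => hx
      | succ l ih =>
        intro x hx
        rw [Nat.mul_add, Nat.mul_one, Nat.add_comm, Function.iterate_add_apply]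
        exact (O1 _ (ih x hx)).le
    refine ⟨q * n, fun l hl x hx => ?_⟩
    have h1 : n ≤ l / q := by
      rw [Nat.le_div_iff_mul_le (by omega), Nat.mul_comm]; exact hl
    have h2 : f^[q*(l/q)] x ∈ B n := by
      show C.τ (f.symm^[q*n] (f^[q*(l/q)] x)) ≤ s1
      rw [e4 _ _ _ (Nat.mul_le_mul_left q h1), ← Nat.mul_sub]
      exact hiter _ x hx
    have h3 := hBO _ h2
    simp only [O', mem_iInter] at h3
    have h4 := h3 (l % q) (Finset.mem_range.2 (Nat.mod_lt _ (by omega)))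
    rw [mem_preimage, ← Function.iterate_add_apply, Nat.mod_add_div] at h4
    exact h4
  have hatt : IsAttractor f Kl := by
    apply att_crit f Kl Cc hKlc hKlinv (subset_interior_iff_mem_nhdsSet.1 hKlint)
    intro O hO hKO
    let Q : ℕ → Set M := fun n => {x | s ≤ C.τ (f.symm^[j*n] x)}
    have hQanti : Antitone Q := by
      apply antitone_nat_of_succ_le
      intro n x hx
      by_contra hc
      have hc' : C.τ (f.symm^[j*n] x) < s := not_le.1 hc
      have := hjs j le_rfl _ (show C.τ (f.symm^[j*n] x) ≤ s2 by linarith)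
      rw [← Function.iterate_add_apply] at this
      have hx' : s ≤ C.τ (f.symm^[j*(n+1)] x) := hx
      rw [Nat.mul_add, Nat.mul_one, Nat.add_comm] at hx'
      linarith
    obtain ⟨n, hn⟩ := (hAcomp.diff hO).elim_directed_family_closed Q
      (fun n => isClosed_le continuous_const (C.hτ.comp (f.symm.continuous.iterate _)))
      (by
        rw [eq_empty_iff_forall_notMem]
        rintro x ⟨hx, hx2⟩
        apply hx.2
        apply hKO
        refine ⟨hx.1, fun hW => ?_⟩
        obtain ⟨n0, h0⟩ := hWlate x hW
        simp only [mem_iInter] at hx2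
        have h1 : s ≤ C.τ (f.symm^[j*n0] x) := hx2 n0
        have h2 := h0 (j*n0) (by nlinarith)
        linarith)
      (fun i j => ⟨max i j, hQanti (le_max_left _ _), hQanti (le_max_right _ _)⟩)
    have hQo : IsOpen (Q n)ᶜ :=
      (isClosed_le continuous_const (C.hτ.comp (f.symm.continuous.iterate (j*n)))).isOpen_compl
    obtain ⟨n1, hn1⟩ := hattA (O ∪ (Q n)ᶜ) (hO.union hQo) (by
      intro x hx
      by_contra hc
      rw [mem_union, not_or] at hc
      have : x ∈ (A \ O) ∩ Q n := ⟨⟨hx, hc.1⟩, not_not.1 hc.2⟩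
      rw [hn] at this
      exact this)
    obtain ⟨L, hL⟩ := hback a ha0
    refine ⟨n1 + (j*n + L), fun i hi x hx => ?_⟩
    rcases hn1 i (by omega) x hx.2 with h | h
    · exact h
    · exfalso
      have h1 : C.τ (f.symm^[j*n] (f^[i] x)) < s := not_le.1 h
      have h2 := hL (i - j*n) (by omega) _ (show C.τ (f.symm^[j*n] (f^[i] x)) ≤ s2 by linarith)
      rw [e4 _ _ _ (by omega), e2] at h2
      have := hx.1
      linarith
  refine ⟨Kl, fun x hx => hx.1, hKlc, hatt, Cc, C.band_compact ha0 hs1,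
    band_homeo C ha0 (by linarith) hs1, hKlint, ?_⟩
  -- the two sides
  have hout : Nonempty (↥({m | C.τ m ≤ s1} \ A) ≃ₜ S × ↥(Ici (0:ℝ))) := by
    have hg : ∀ n : ℕ, (homeoIter f q).symm^[n] = f.symm^[q*n] := by
      intro n; rw [homeoIter_symm_apply, Function.iterate_mul]
    have h := outer_side C.rev (homeoIter f q) (a := 1 - s1) (β := 1 - δ) (b := 1 - δ/2)
      (by linarith) (by linarith) (by linarith) (by linarith)
      (by
        intro m hm
        have hm' : 1 - s1 ≤ 1 - C.τ m := hm
        show 1 - s1 < 1 - C.τ _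
        rw [homeoIter_apply]
        have := O1 m (by linarith)
        linarith)
      (by
        intro m hm
        have hm' : 1 - δ ≤ 1 - C.τ m := hm
        show 1 - s1 < 1 - C.τ _
        rw [homeoIter_symm_apply]
        have := O2 m (by linarith)
        linarith)
      ⟨k, by
        intro m hm
        have hm' : 1 - s1 ≤ 1 - C.τ m := hm
        show 1 - δ/2 ≤ 1 - C.τ _
        rw [homeoIter_apply, ← Function.iterate_mul]
        have := O3 m (by linarith)
        linarith⟩
    have hset : ({m | C.τ m ≤ s1} \ A) = ({m | 1 - s1 ≤ C.rev.τ m} \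
        {m | ∀ n : ℕ, 1 - s1 ≤ C.rev.τ ((homeoIter f q).symm^[n] m)}) := by
      have hle : ∀ m, (1 - s1 ≤ C.rev.τ m) ↔ C.τ m ≤ s1 := by
        intro m
        show 1 - s1 ≤ 1 - C.τ m ↔ _
        constructor <;> intro h <;> linarith
      ext m
      simp only [hle, hg]
      rfl
    rw [hset]; exact h
  have hin : Nonempty (↥({m | a ≤ C.τ m} ∩ W) ≃ₜ S × ↥(Ici (0:ℝ))) := by
    have hg : ∀ n : ℕ, (homeoIter f j).symm^[n] = f.symm^[j*n] := by
      intro n; rw [homeoIter_symm_apply, Function.iterate_mul]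
    have hg' : ∀ n : ℕ, (homeoIter f j)^[n] = f^[j*n] := by
      intro n; rw [homeoIter_apply, Function.iterate_mul]
    have hsm : ∀ (φ : M ≃ₜ M), φ '' K = K → ∀ n : ℕ, ∀ ε > 0, ∃ r > 0, ∀ m, C.τ m ≤ r → C.τ (φ^[n] m) < ε := by
      intro φ hφ n ε hε
      obtain ⟨r, hr, _, _, h⟩ := sub_basis C K hτ0 hK hcomp (φ^[n] ⁻¹' {m | C.τ m < ε})
        ((hopen ε).preimage (φ.continuous.iterate n)) (by
          intro x hx
          have h1 := iter_mem_of_image hφ n hx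
          rw [hK] at h1
          exact lt_of_le_of_lt h1 hε) one_pos
      exact ⟨r, hr, h⟩
    have h := inner_side C (homeoIter f j) (a := a) (β := s/2) (s := s) (s2 := s2) ha0 (by linarith)
      (by linarith) hss2 hs21
      (by
        intro m hm
        rw [homeoIter_symm_apply]
        exact hjs j le_rfl m hm)
      (by intro n; rw [hg']; exact hsm f hKinv' _)
      (by intro n; rw [hg]; exact hsm f.symm hKinv _)
    have hset : ({m | a ≤ C.τ m} ∩ W) = ({m | a ≤ C.τ m} \
        {m | ∀ n : ℕ, s ≤ C.τ ((homeoIter f j).symm^[n] m)}) := by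
      ext m
      simp only [hg]
      constructor
      · rintro ⟨h1, h2⟩
        refine ⟨h1, fun h3 => ?_⟩
        obtain ⟨n0, h0⟩ := hWlate m h2
        have h4 := h0 (j*n0) (by nlinarith)
        have h5 : s ≤ C.τ (f.symm^[j*n0] m) := h3 n0
        linarith
      · rintro ⟨h1, h2⟩
        refine ⟨h1, ?_⟩
        by_contra hc
        apply h2
        intro n
        by_contra hc2
        exact hc ⟨j*n, not_le.1 hc2⟩
    rw [hset]; exact h
  obtain ⟨eo⟩ := hout
  obtain ⟨ei⟩ := hin
  obtain ⟨eb⟩ := band_bdry hM C ha0 (show a < s1 by linarith) hs1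
  obtain ⟨es⟩ := sum_homeo ({m | C.τ m ≤ s1} \ A) ({m | a ≤ C.τ m} ∩ W) (Cc \ Kl) (by
      ext m
      constructor
      · rintro ⟨⟨h1, h2⟩, h3⟩
        by_cases hm : m ∈ A
        · right
          refine ⟨h1, ?_⟩
          by_contra hc
          exact h3 ⟨hm, hc⟩
        · exact Or.inl ⟨h2, hm⟩
      · rintro (⟨h1, h2⟩ | ⟨h1, h2⟩)
        · refine ⟨⟨?_, h1⟩, fun h => h2 h.1⟩
          by_contra hc
          push Not at hc
          exact h2 (hWA (haW m (by linarith)))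
        · exact ⟨⟨h1, hWA h2 0⟩, fun h => h.2 h2⟩)
    Aᶜ W hAcl.isOpen_compl hWopen (fun m hm => hm.2) (fun m hm => hm.2)
    (Set.disjoint_left.2 (fun m hm h => hm.2 (hWA h)))
    (Set.disjoint_left.2 (fun m hm h => h (hWA hm.2)))
  exact ⟨es.symm.trans (((eo.sumCongr ei).trans Homeomorph.sumProdDistrib.symm).trans
    (eb.prodCongr (Homeomorph.refl _)))⟩

end Fixed2

/-- **Hopf bifurcation of a 3-manifold with boundary inside a 3-manifold.** If `K ⊆ M`
is a compact 3-manifold with boundary whose boundary is bicollared in `M`, which is an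
attractor of `f₀` and a repeller of `f_λ` for every `λ > 0`, then for all sufficiently
small `λ > 0` there is a compact attractor `K_λ` of `f_λ` which is a topological spine
of a compact subset of `M` homeomorphic to `∂K × [0,1]`, converging to `K` upper
semicontinuously as `λ → 0`. -/
theorem hopf_three_manifold_with_boundary
    {M : Type*} [MetricSpace M] [LocallyCompactSpace M]
    (hM : LocallyEuclidean 3 M)
    (K : Set M) (hK : IsCompactMfldBdry 3 K)
    (hbicol : Bicollared (subsetBoundary 3 K))
    (f : unitInterval → M ≃ₜ M) (hf : ContinuousFamily f)
    (hKattr : IsAttractor (f 0) K)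
    (hhopf : ∀ lam : unitInterval, 0 < (lam : ℝ) → IsRepeller (f lam) K) :
    ∃ lam₀ : ℝ, 0 < lam₀ ∧ ∃ Kfam : unitInterval → Set M,
      (∀ lam : unitInterval, 0 < (lam : ℝ) → (lam : ℝ) < lam₀ →
        IsCompact (Kfam lam) ∧ IsAttractor (f lam) (Kfam lam) ∧
        ∃ C : Set M, IsCompact C ∧
          Nonempty (↥C ≃ₜ ↥(subsetBoundary 3 K) × ↥(Set.Icc (0 : ℝ) 1)) ∧
          IsSpine 3 C (Kfam lam)) ∧
      (∀ V : Set M, V ∈ 𝓝ˢ K → ∃ lam₁ : ℝ, 0 < lam₁ ∧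
        ∀ lam : unitInterval, 0 < (lam : ℝ) → (lam : ℝ) < lam₁ → Kfam lam ⊆ V) := by
  have hbc : IsCompact (subsetBoundary 3 K) := by
    rw [bdry_eq hM K]
    exact hK.1.diff isOpen_interior
  have : CompactSpace ↥(subsetBoundary 3 K) := isCompact_iff_compactSpace.1 hbc
  rcases (subsetBoundary 3 K).eq_empty_or_nonempty with hemp | hne
  · have : IsEmpty ↥(subsetBoundary 3 K) := isEmpty_coe_sort.2 hemp
    refine ⟨1, one_pos, fun _ => ∅, ?_, fun V _ => ⟨1, one_pos, fun _ _ _ => empty_subset V⟩⟩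
    intro lam _ _
    have hE : IsEmpty ↥(∅ : Set M) := isEmpty_coe_sort.2 rfl
    have hb0 : subsetBoundary 3 (∅ : Set M) = ∅ := by
      rw [bdry_eq hM]; simp
    have : IsEmpty ↥(subsetBoundary 3 (∅ : Set M)) := isEmpty_coe_sort.2 hb0
    have : IsEmpty ↥((∅ : Set M) \ ∅) := isEmpty_coe_sort.2 (by simp)
    refine ⟨isCompact_empty, ?_, ∅, isCompact_empty, ⟨Homeomorph.empty⟩, empty_subset _, ⟨Homeomorph.empty⟩⟩
    refine att_crit _ _ ∅ isCompact_empty (image_empty _) ?_ ?_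
    · simp
    · intro O _ _
      exact ⟨0, fun n _ x hx => absurd hx (notMem_empty x)⟩
  obtain ⟨C, hτ0, hKτ, hcomp⟩ := collar_exists hM K hK hbicol hne
  obtain ⟨hinv, V, hV, hVatt⟩ := att_lemma (f 0) K hKattr
  have hinv' := symm_image_of_image hinv
  have hopen : ∀ r : ℝ, IsOpen {m | C.τ m < r} := fun r => isOpen_lt C.hτ continuous_const
  have hKr : ∀ r > 0, K ⊆ {m | C.τ m < r} := by
    intro r hr m hm
    rw [hKτ] at hm
    exact lt_of_le_of_lt hm hr
  obtain ⟨s1, hs10, hs1e, hs11, hs1V⟩ := sub_basis C K hτ0 hKτ hcomp (interior V) isOpen_interior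
    (subset_interior_iff_mem_nhdsSet.2 hV) one_pos
  have hs1V' : ∀ m, C.τ m ≤ s1 → m ∈ V := fun m hm => interior_subset (hs1V m hm)
  obtain ⟨q0, hq0⟩ := hVatt {m | C.τ m < s1} (hopen s1) (hKr s1 hs10)
  obtain ⟨q, hq1, hqq⟩ : ∃ q, 1 ≤ q ∧ q0 ≤ q := ⟨max q0 1, le_max_right _ _, le_max_left _ _⟩
  -- choice of the small level
  let D : Set M := ((f 0).symm^[q] ⁻¹' {m | C.τ m < s1}) ∩
    ⋂ i ∈ Finset.range (q+1), (f 0)^[i] ⁻¹' {m | C.τ m < s1}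
  have hD : IsOpen D := ((hopen s1).preimage ((f 0).symm.continuous.iterate q)).inter
    (isOpen_biInter_finset (fun i _ => (hopen s1).preimage ((f 0).continuous.iterate i)))
  have hKD : K ⊆ D := by
    intro x hx
    refine ⟨hKr s1 hs10 (iter_mem_of_image hinv' q hx), ?_⟩
    simp only [mem_iInter]
    exact fun i _ => hKr s1 hs10 (iter_mem_of_image hinv i hx)
  obtain ⟨δ, hδ0, hδs, hδ1, hδD⟩ := sub_basis C K hτ0 hKτ hcomp D hD hKD hs10
  obtain ⟨k, hk⟩ := hVatt {m | C.τ m < δ/2} (hopen _) (hKr _ (by linarith))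
  have hcN := hcomp s1 hs11
  have hcδ := hcomp δ hδ1
  have c1 := iter_cont f hf.1
  have c2 := iter_cont (fun l => (f l).symm) hf.2
  obtain ⟨ε1, hε1, p1⟩ := persist _ (c1 q) _ _ hcN (hopen s1)
    (fun x hx => hq0 q hqq x (hs1V' x hx))
  obtain ⟨ε2, hε2, p2⟩ := persist _ (c2 q) _ _ hcδ (hopen s1)
    (fun x hx => (hδD x hx).1)
  obtain ⟨ε3, hε3, p3⟩ := persist _ (c1 (q*k)) _ _ hcN (hopen (δ/2))
    (fun x hx => hk (q*k) (by nlinarith) x (hs1V' x hx))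
  have p4 : ∀ i, ∃ ε > (0:ℝ), i ≤ q → ∀ lam : unitInterval, (lam : ℝ) < ε →
      ∀ x, C.τ x ≤ δ → C.τ ((f lam)^[i] x) < s1 := by
    intro i
    by_cases hi : i ≤ q
    · obtain ⟨ε, hε, p⟩ := persist _ (c1 i) _ _ hcδ (hopen s1) (fun x hx => by
        have h := (hδD x hx).2
        simp only [mem_iInter] at h
        exact h i (Finset.mem_range.2 (by omega)))
      exact ⟨ε, hε, fun _ => p⟩
    · exact ⟨1, one_pos, fun h => absurd h hi⟩
  choose ε4 hε4 p4 using p4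
  obtain ⟨ε5, hε5, p5⟩ : ∃ ε > (0:ℝ), ∀ i ≤ q, ε ≤ ε4 i := by
    obtain ⟨i0, _, h0⟩ := (Finset.range (q+1)).exists_min_image ε4 ⟨0, Finset.mem_range.2 (by omega)⟩
    exact ⟨ε4 i0, hε4 i0, fun i hi => h0 i (Finset.mem_range.2 (by omega))⟩
  have main : ∀ lam : unitInterval, ∃ Kl : Set M, 0 < (lam : ℝ) →
      (lam : ℝ) < min (min ε1 ε2) (min ε3 ε5) →
      (Kl ⊆ {x | ∀ n : ℕ, C.τ ((f lam).symm^[q*n] x) ≤ s1}) ∧ IsCompact Kl ∧ IsAttractor (f lam) Kl ∧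
      ∃ Cc : Set M, IsCompact Cc ∧ Nonempty (↥Cc ≃ₜ ↥(subsetBoundary 3 K) × ↥(Icc (0:ℝ) 1)) ∧
        IsSpine 3 Cc Kl := by
    intro lam
    by_cases hl : 0 < (lam : ℝ) ∧ (lam : ℝ) < min (min ε1 ε2) (min ε3 ε5)
    · obtain ⟨hl0, hl1⟩ := hl
      simp only [lt_min_iff] at hl1
      obtain ⟨Kl, h1, h2⟩ := fixed_lam hM C K hτ0 hKτ hcomp (f lam) (hhopf lam hl0) hδ0 hδs hs11 q k hq1
        (p1 lam hl1.1.1) (p2 lam hl1.1.2) (p3 lam hl1.2.1)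
        (fun i hi => p4 i hi lam (hl1.2.2.trans_le (p5 i hi)))
      exact ⟨Kl, fun _ _ => ⟨h1, h2⟩⟩
    · exact ⟨∅, fun h1 h2 => absurd ⟨h1, h2⟩ hl⟩
  choose Kfam hKfam using main
  have hε : 0 < min (min ε1 ε2) (min ε3 ε5) := lt_min (lt_min hε1 hε2) (lt_min hε3 hε5)
  refine ⟨_, hε, Kfam, fun lam h1 h2 => (hKfam lam h1 h2).2, ?_⟩
  intro O hO
  obtain ⟨n, hn⟩ := hVatt (interior O) isOpen_interior (subset_interior_iff_mem_nhdsSet.2 hO)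
  obtain ⟨ε6, hε6, p6⟩ := persist _ (c1 (q*n)) _ _ hcN isOpen_interior
    (fun x hx => hn (q*n) (by nlinarith) x (hs1V' x hx))
  refine ⟨min ε6 (min (min ε1 ε2) (min ε3 ε5)), lt_min hε6 hε, fun lam h1 h2 x hx => ?_⟩
  have h3 := (hKfam lam h1 (h2.trans_le (min_le_right _ _))).1 hx n
  have h4 := p6 lam (h2.trans_le (min_le_left _ _)) _ h3
  have h5 : (f lam)^[q*n] ((f lam).symm^[q*n] x) = x :=
    Function.LeftInverse.iterate (f := (f lam).symm) (g := f lam) (f lam).apply_symm_apply (q*n) x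
  have h6 : (f lam)^[q*n] ((f lam).symm^[q*n] x) ∈ interior O := h4
  rw [h5] at h6
  exact interior_subset h6
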